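/- Let n ≥ 3. Let g : (S^n \ {n, s}) × (0,∞) → ℝ be continuous with g(·,s) bounded from below on S^n \ {n, s} for each s ∈ (0,∞), and suppose: (g1) there is a function G with g(θ,s) = G(θ_{n+1}, s) for all θ and s; (g3) for each t ∈ (−1,1), the map s ↦ s^{−(n+2)/(n−2)} G(t,s) is non-increasing on (0,∞); (g5) G(t,s) ≥ G(t',s) whenever 1 > t > t' > 0, and G(t,s) ≥ G(t',s) whenever −1 < t < t' < 0; (g6) either all the inequalities in (g5) are strict, or for each t ∈ (−1,1) the map s ↦ s^{−(n+2)/(n−2)} G(t,s) is strictly decreasing on (0,∞). If v ∈ C²(S^n \ {n, s}) is positive, satisfies −L_{S^n} v(θ) = g(θ, v(θ)) for all θ ∈ S^n \ {n, s}, and liminf_{θ → n} v(θ) > 0 and liminf_{θ → s} v(θ) > 0, then v is rotationally symmetric about the line through n and s. -/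

import Mathlib

open scoped BigOperators

/-- The Euclidean Laplacian of `u : ℝᵐ → ℝ` at `x`, as the sum of the pure second
derivatives in the standard coordinate directions. -/
noncomputable def eLaplacian {m : ℕ} (u : EuclideanSpace ℝ (Fin m) → ℝ)
    (x : EuclideanSpace ℝ (Fin m)) : ℝ :=
  ∑ i : Fin m, iteratedFDeriv ℝ 2 u x ![EuclideanSpace.single i 1, EuclideanSpace.single i 1]

/-- The Laplace–Beltrami operator on the unit sphere: apply the Euclidean Laplacian to the
degree-zero homogeneous extension `x ↦ v (x/|x|)` and evaluate at a point of the sphere. -/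
noncomputable def sphLaplacian {m : ℕ} (v : EuclideanSpace ℝ (Fin m) → ℝ)
    (θ : EuclideanSpace ℝ (Fin m)) : ℝ :=
  eLaplacian (fun x => v (‖x‖⁻¹ • x)) θ

section MovingPlaneMethod

open Filter Topology
open scoped Laplacian InnerProductSpace

section Calculus

variable {E : Type*} [NormedAddCommGroup E] [InnerProductSpace ℝ E]

theorem laplacian_eq_sum_fderiv_fderiv [FiniteDimensional ℝ E] {ι : Type*} [Fintype ι]
    (b : OrthonormalBasis ι ℝ E) (f : E → ℝ) (x : E) :
    Δ f x = ∑ i, fderiv ℝ (fderiv ℝ f) x (b i) (b i) := by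
  rw [InnerProductSpace.laplacian_eq_iteratedFDeriv_orthonormalBasis f b]
  simp [iteratedFDeriv_two_apply]

theorem ContDiffAt.eventually_hasFDerivAt {f : E → ℝ} {x : E} (hf : ContDiffAt ℝ 2 f x) :
    ∀ᶠ y in 𝓝 x, HasFDerivAt f (fderiv ℝ f y) y := by
  filter_upwards [hf.eventually (by simp)] with y hy
  exact (hy.differentiableAt (by simp)).hasFDerivAt

theorem ContDiffAt.hasFDerivAt_fderiv {f : E → ℝ} {x : E} (hf : ContDiffAt ℝ 2 f x) :
    HasFDerivAt (fderiv ℝ f) (fderiv ℝ (fderiv ℝ f) x) x :=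
  ((hf.fderiv_right (m := 1) (by norm_num)).differentiableAt (by simp)).hasFDerivAt

/-- Second derivative of a `C²` function along a curve. -/
theorem second_deriv_along_curve {f : E → ℝ} {c c' : ℝ → E} {c'' : E} {s : ℝ}
    (hf : ContDiffAt ℝ 2 f (c s)) (hc : ∀ t, HasDerivAt c (c' t) t) (hc' : HasDerivAt c' c'' s) :
    (∀ᶠ t in 𝓝 s, HasDerivAt (fun t => f (c t)) (fderiv ℝ f (c t) (c' t)) t) ∧
      HasDerivAt (fun t => fderiv ℝ f (c t) (c' t))
        (fderiv ℝ (fderiv ℝ f) (c s) (c' s) (c' s) + fderiv ℝ f (c s) c'') s := by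
  constructor
  · filter_upwards [(hc s).continuousAt.eventually hf.eventually_hasFDerivAt] with t ht
    exact ht.comp_hasDerivAt t (hc t)
  · exact (hf.hasFDerivAt_fderiv.comp_hasDerivAt s (hc s)).clm_apply hc'

theorem fderiv_fderiv_eq_of_curve {f : E → ℝ} {c c' : ℝ → E} {c'' : E} {s : ℝ} {φ' : ℝ → ℝ} {φ'' : ℝ}
    (hf : ContDiffAt ℝ 2 f (c s)) (hc : ∀ t, HasDerivAt c (c' t) t) (hc' : HasDerivAt c' c'' s)
    (hφ : ∀ᶠ t in 𝓝 s, HasDerivAt (fun t => f (c t)) (φ' t) t) (hφ' : HasDerivAt φ' φ'' s) :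
    fderiv ℝ (fderiv ℝ f) (c s) (c' s) (c' s) + fderiv ℝ f (c s) c'' = φ'' := by
  obtain ⟨h1, h2⟩ := second_deriv_along_curve hf hc hc'
  have : (fun t => fderiv ℝ f (c t) (c' t)) =ᶠ[𝓝 s] φ' := by
    filter_upwards [h1, hφ] with t ha hb
    exact ha.unique hb
  exact h2.unique (hφ'.congr_of_eventuallyEq this)

theorem hasDerivAt_line (x v : E) (t : ℝ) : HasDerivAt (fun t : ℝ => x + t • v) v t := by
  simpa using ((hasDerivAt_id t).smul_const v).const_add x

theorem fderiv_fderiv_eq_of_line {f : E → ℝ} {x v : E} {φ' : ℝ → ℝ} {φ'' : ℝ}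
    (hf : ContDiffAt ℝ 2 f x)
    (hφ : ∀ᶠ t in 𝓝 (0 : ℝ), HasDerivAt (fun t : ℝ => f (x + t • v)) (φ' t) t)
    (hφ' : HasDerivAt φ' φ'' 0) :
    fderiv ℝ (fderiv ℝ f) x v v = φ'' := by
  have := fderiv_fderiv_eq_of_curve (c := fun t : ℝ => x + t • v) (c' := fun _ => v) (c'' := 0)
    (s := 0) (by simpa using hf) (hasDerivAt_line x v) (hasDerivAt_const _ _) hφ hφ'
  simpa using this

theorem fderiv_fderiv_nonpos_of_isLocalMax {f : E → ℝ} {x : E} (hf : ContDiffAt ℝ 2 f x)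
    (hmax : IsLocalMax f x) (v : E) : fderiv ℝ (fderiv ℝ f) x v v ≤ 0 := by
  by_contra! hpos
  obtain ⟨h1, h2⟩ := second_deriv_along_curve (c := fun t : ℝ => x + t • v) (c' := fun _ => v)
    (c'' := 0) (s := 0) (f := f) (by simpa using hf) (hasDerivAt_line x v) (hasDerivAt_const _ _)
  set γ : ℝ → ℝ := fun t => f (x + t • v) with hγ
  have hd : deriv γ =ᶠ[𝓝 0] fun t => fderiv ℝ f (x + t • v) v := by
    filter_upwards [h1] with t ht using ht.deriv
  have hdd : deriv (deriv γ) 0 = fderiv ℝ (fderiv ℝ f) x v v := by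
    rw [hd.deriv_eq, h2.deriv]; simp
  have hγmax : IsLocalMax γ 0 := by
    have hc : ContinuousAt (fun t : ℝ => x + t • v) 0 := by fun_prop
    have := hc.eventually (p := fun y => f y ≤ f (x + (0:ℝ) • v))
      (by simpa [IsLocalMax, IsMaxFilter] using hmax)
    exact this
  have hγmin : IsLocalMin γ 0 :=
    isLocalMin_of_deriv_deriv_pos (by rw [hdd]; exact hpos) hγmax.deriv_eq_zero
      h1.self_of_nhds.continuousAt
  have hconst : γ =ᶠ[𝓝 0] fun _ => γ 0 := by
    filter_upwards [hγmax, hγmin] with t a b using le_antisymm a b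
  have h0 : deriv (deriv γ) 0 = 0 := by
    have : deriv γ =ᶠ[𝓝 0] fun _ => 0 := by
      have := hconst.deriv
      simpa using this
    rw [this.deriv_eq]; simp
  rw [hdd] at h0
  exact hpos.ne' h0

theorem contDiffAt_rpow_normSq {ε a : ℝ} {x : E} (hx : 0 < ε + ‖x‖ ^ 2) :
    ContDiffAt ℝ 2 (fun y : E => (ε + ‖y‖ ^ 2) ^ a) x :=
  (contDiffAt_const.add (contDiff_norm_sq ℝ).contDiffAt).rpow_const_of_ne hx.ne'

variable [FiniteDimensional ℝ E]

theorem laplacian_nonpos_of_isLocalMax {f : E → ℝ} {x : E} (hf : ContDiffAt ℝ 2 f x)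
    (hmax : IsLocalMax f x) : Δ f x ≤ 0 := by
  rw [laplacian_eq_sum_fderiv_fderiv (stdOrthonormalBasis ℝ E)]
  exact Finset.sum_nonpos fun i _ => fderiv_fderiv_nonpos_of_isLocalMax hf hmax _

theorem laplacian_le_of_touching {f h : E → ℝ} {x : E} (hf : ContDiffAt ℝ 2 f x)
    (hh : ContDiffAt ℝ 2 h x) (hle : ∀ᶠ y in 𝓝 x, f y ≤ h y) (heq : f x = h x) :
    Δ f x ≤ Δ h x := by
  have := laplacian_nonpos_of_isLocalMax (hf.sub hh) (x := x) (by
    filter_upwards [hle] with y hy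
    simp only [heq, sub_self]; linarith)
  have h2 : Δ (fun y => f y - h y) x = Δ f x - Δ h x := hf.laplacian_sub hh
  rw [h2] at this
  linarith

theorem laplacian_rpow_normSq {ε a : ℝ} {x : E} (hx : 0 < ε + ‖x‖ ^ 2) :
    Δ (fun y : E => (ε + ‖y‖ ^ 2) ^ a) x =
      2 * a * Module.finrank ℝ E * (ε + ‖x‖ ^ 2) ^ (a - 1) +
        4 * a * (a - 1) * ‖x‖ ^ 2 * (ε + ‖x‖ ^ 2) ^ (a - 2) := by
  have key : ∀ v : E, ‖v‖ = 1 →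
      fderiv ℝ (fderiv ℝ (fun y : E => (ε + ‖y‖ ^ 2) ^ a)) x v v =
      2 * a * (ε + ‖x‖ ^ 2) ^ (a - 1) +
        4 * a * (a - 1) * ⟪v, x⟫_ℝ ^ 2 * (ε + ‖x‖ ^ 2) ^ (a - 2) := by
    intro v hv
    have hq : ∀ t : ℝ, ‖x + t • v‖ ^ 2 = ‖x‖ ^ 2 + 2 * t * ⟪v, x⟫_ℝ + t ^ 2 := by
      intro t
      rw [norm_add_sq_real, norm_smul, inner_smul_right, real_inner_comm, hv]
      simp; ring
    set B := ⟪v, x⟫_ℝ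
    have hd : ∀ t, HasDerivAt (fun t : ℝ => ε + (‖x‖ ^ 2 + 2 * t * B + t ^ 2)) (2 * B + 2 * t) t := by
      intro t
      have := ((((hasDerivAt_id t).const_mul 2).mul_const B).const_add (‖x‖ ^ 2)).add
        (hasDerivAt_pow 2 t) |>.const_add ε
      simpa [Pi.add_def] using this
    refine fderiv_fderiv_eq_of_line (φ' := fun t => (2 * B + 2 * t) * a *
      (ε + (‖x‖ ^ 2 + 2 * t * B + t ^ 2)) ^ (a - 1)) (contDiffAt_rpow_normSq hx) ?_ ?_
    · have : ∀ᶠ t in 𝓝 (0:ℝ), ε + (‖x‖ ^ 2 + 2 * t * B + t ^ 2) ≠ 0 := by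
        apply (hd 0).continuousAt.eventually_ne
        simpa using hx.ne'
      filter_upwards [this] with t ht
      simp_rw [hq]
      exact (hd t).rpow_const (Or.inl ht)
    · have h1 := (hd 0).rpow_const (p := a - 1) (Or.inl (by simpa using hx.ne'))
      have h2 : HasDerivAt (fun t : ℝ => (2 * B + 2 * t) * a) (2 * a) 0 := by
        simpa using (((hasDerivAt_id (0:ℝ)).const_mul 2).const_add (2 * B)).mul_const a
      refine (h2.mul h1).congr_deriv ?_
      have : a - 1 - 1 = a - 2 := by ring
      simp [this]
      ring
  rw [laplacian_eq_sum_fderiv_fderiv (stdOrthonormalBasis ℝ E)]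
  simp_rw [key _ ((stdOrthonormalBasis ℝ E).norm_eq_one _)]
  rw [Finset.sum_add_distrib, Finset.sum_const, ← Finset.sum_mul, ← Finset.mul_sum,
    OrthonormalBasis.sum_sq_inner_right]
  simp only [Finset.card_univ, Fintype.card_fin, nsmul_eq_mul]
  ring

theorem laplacian_comp_inner {ψ ψ' : ℝ → ℝ} {ψ'' : ℝ} {a x : E} {d : ℝ} (ha : ‖a‖ = 1)
    (hψ : ContDiff ℝ 2 ψ) (h1 : ∀ t, HasDerivAt ψ (ψ' t) t)
    (h2 : HasDerivAt ψ' ψ'' (⟪x, a⟫_ℝ - d)) :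
    Δ (fun y : E => ψ (⟪y, a⟫_ℝ - d)) x = ψ'' := by
  have key : ∀ v : E,
      fderiv ℝ (fderiv ℝ (fun y : E => ψ (⟪y, a⟫_ℝ - d))) x v v = ψ'' * ⟪v, a⟫_ℝ ^ 2 := by
    intro v
    have hl : ∀ t, HasDerivAt (fun t : ℝ => ⟪x + t • v, a⟫_ℝ - d) (⟪v, a⟫_ℝ) t := by
      intro t
      simp_rw [inner_add_left, inner_smul_left]
      simpa using (((hasDerivAt_id t).mul_const ⟪v, a⟫_ℝ).const_add ⟪x, a⟫_ℝ).sub_const d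
    refine fderiv_fderiv_eq_of_line (φ' := fun t => ψ' (⟪x + t • v, a⟫_ℝ - d) * ⟪v, a⟫_ℝ) ?_ ?_ ?_
    · exact hψ.contDiffAt.comp x ((contDiffAt_id.inner ℝ contDiffAt_const).sub contDiffAt_const)
    · exact Eventually.of_forall fun t => (h1 _).comp t (hl t)
    · have h2' : HasDerivAt ψ' ψ'' (⟪x + (0:ℝ) • v, a⟫_ℝ - d) := by simpa using h2
      refine ((h2'.comp (0:ℝ) (hl 0)).mul_const ⟪v, a⟫_ℝ).congr_deriv ?_
      ring
  rw [laplacian_eq_sum_fderiv_fderiv (stdOrthonormalBasis ℝ E)]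
  simp_rw [key]
  rw [← Finset.mul_sum, OrthonormalBasis.sum_sq_inner_right, ha]
  simp

theorem laplacian_comp_affineIsometry (T : E ≃ₗᵢ[ℝ] E) (d : E) (f : E → ℝ) (x : E)
    (hf : ContDiffAt ℝ 2 f (T x + d)) :
    Δ (fun y => f (T y + d)) x = Δ f (T x + d) := by
  set b := stdOrthonormalBasis ℝ E
  rw [laplacian_eq_sum_fderiv_fderiv b, laplacian_eq_sum_fderiv_fderiv (b.map T)]
  refine Finset.sum_congr rfl fun i _ => ?_
  have hc : ∀ t : ℝ, HasDerivAt (fun t : ℝ => T (x + t • b i) + d) (T (b i)) t := by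
    intro t
    exact (T.toContinuousLinearEquiv.toContinuousLinearMap.hasFDerivAt.comp_hasDerivAt t
      (hasDerivAt_line x (b i) t)).add_const d
  obtain ⟨h1, h2⟩ := second_deriv_along_curve (c := fun t : ℝ => T (x + t • b i) + d)
    (c' := fun _ => T (b i)) (c'' := 0) (s := 0) (f := f) (by simpa using hf) hc
    (hasDerivAt_const _ _)
  have hg : ContDiffAt ℝ 2 (fun y => f (T y + d)) x :=
    hf.comp x (T.contDiff.add contDiff_const).contDiffAt
  rw [fderiv_fderiv_eq_of_line hg h1 h2]
  simp
end Calculus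

section Barriers

variable {F : Type*} [NormedAddCommGroup F] [InnerProductSpace ℝ F] [FiniteDimensional ℝ F]

theorem laplacian_fun_sub {f h : F → ℝ} {x : F} (hf : ContDiffAt ℝ 2 f x)
    (hh : ContDiffAt ℝ 2 h x) : Δ (fun y => f y - h y) x = Δ f x - Δ h x :=
  hf.laplacian_sub hh

theorem laplacian_fun_add {f h : F → ℝ} {x : F} (hf : ContDiffAt ℝ 2 f x)
    (hh : ContDiffAt ℝ 2 h x) : Δ (fun y => f y + h y) x = Δ f x + Δ h x :=
  hf.laplacian_add hh

theorem laplacian_fun_const_mul {f : F → ℝ} {x : F} (c : ℝ) (hf : ContDiffAt ℝ 2 f x) :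
    Δ (fun y => c * f y) x = c * Δ f x :=
  InnerProductSpace.laplacian_smul c hf

/-- A power of the squared norm that is strictly superharmonic in dimension at least three. -/
theorem laplacian_rpow_neg_quarter_le {ε : ℝ} (hε : 0 ≤ ε) {x : F} (hx : 0 < ε + ‖x‖ ^ 2)
    (hdim : 3 ≤ Module.finrank ℝ F) :
    Δ (fun y : F => (ε + ‖y‖ ^ 2) ^ (-(1 / 4) : ℝ)) x ≤
      -(1 / 4) * (ε + ‖x‖ ^ 2) ^ (-(1 / 4) : ℝ) / (ε + ‖x‖ ^ 2) := by
  rw [laplacian_rpow_normSq hx]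
  set q := ε + ‖x‖ ^ 2 with hq
  have e1 : q ^ (-(1 / 4) - 1 : ℝ) = q ^ (-(1 / 4) : ℝ) / q := by
    rw [Real.rpow_sub_one hx.ne']
  have e2 : q ^ (-(1 / 4) - 2 : ℝ) = q ^ (-(1 / 4) : ℝ) / q ^ 2 := by
    rw [Real.rpow_sub hx]; norm_cast
  rw [e1, e2]
  have hA : 0 < q ^ (-(1 / 4) : ℝ) := Real.rpow_pos_of_pos hx _
  set A := q ^ (-(1 / 4) : ℝ)
  have hd : (3 : ℝ) ≤ Module.finrank ℝ F := by exact_mod_cast hdim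
  set d : ℝ := (Module.finrank ℝ F : ℝ)
  have hn : ‖x‖ ^ 2 ≤ q := by linarith
  have h1 : 4 * (-(1 / 4)) * (-(1 / 4) - 1) * ‖x‖ ^ 2 * (A / q ^ 2) ≤ 5 / 4 * (A / q) := by
    have : A / q = q * (A / q ^ 2) := by field_simp
    rw [this]
    have : 0 < A / q ^ 2 := by positivity
    nlinarith
  have h2 : 0 < A / q := by positivity
  have h3 : -(1 / 4) * A / q = -(1 / 4) * (A / q) := by ring
  rw [h3]
  nlinarith

theorem contDiff_sqrt_add_sq {δ : ℝ} (hδ : 0 < δ) : ContDiff ℝ 2 fun t : ℝ => √(δ ^ 2 + t ^ 2) :=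
  (contDiff_const.add (contDiff_id.pow 2)).sqrt fun t => by simp only [id]; positivity

theorem laplacian_sqrt_inner {δ d : ℝ} (hδ : 0 < δ) {a x : F} (ha : ‖a‖ = 1) :
    Δ (fun y : F => √(δ ^ 2 + (⟪y, a⟫_ℝ - d) ^ 2)) x =
      δ ^ 2 / √(δ ^ 2 + (⟪x, a⟫_ℝ - d) ^ 2) ^ 3 := by
  have hd : ∀ t : ℝ, HasDerivAt (fun t : ℝ => √(δ ^ 2 + t ^ 2)) (t / √(δ ^ 2 + t ^ 2)) t := by
    intro t
    have h : HasDerivAt (fun t : ℝ => δ ^ 2 + t ^ 2) (2 * t) t := by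
      simpa using (hasDerivAt_pow 2 t).const_add (δ ^ 2)
    refine (h.sqrt (by positivity)).congr_deriv ?_
    rw [mul_div_mul_left _ _ two_ne_zero]
  refine laplacian_comp_inner (ψ := fun t => √(δ ^ 2 + t ^ 2)) ha (contDiff_sqrt_add_sq hδ) hd ?_
  set t := ⟪x, a⟫_ℝ - d
  have hpos : 0 < √(δ ^ 2 + t ^ 2) := Real.sqrt_pos.2 (by positivity)
  refine ((hasDerivAt_id t).div (hd t) hpos.ne').congr_deriv ?_
  have hs : √(δ ^ 2 + t ^ 2) ^ 2 = δ ^ 2 + t ^ 2 := Real.sq_sqrt (by positivity)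
  set s := √(δ ^ 2 + t ^ 2)
  simp only [id]
  field_simp
  rw [hs]; ring

theorem inv_le_laplacian_sqrt_inner {δ d : ℝ} (hδ : 0 < δ) {a x : F} (ha : ‖a‖ = 1)
    (hx : |⟪x, a⟫_ℝ - d| ≤ δ) :
    1 / (4 * δ) ≤ Δ (fun y : F => √(δ ^ 2 + (⟪y, a⟫_ℝ - d) ^ 2)) x := by
  rw [laplacian_sqrt_inner hδ ha]
  set t := ⟪x, a⟫_ℝ - d
  have ht : t ^ 2 ≤ δ ^ 2 := sq_le_sq' (by linarith [neg_abs_le t]) (by linarith [le_abs_self t])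
  have hpos : 0 < √(δ ^ 2 + t ^ 2) := Real.sqrt_pos.2 (by positivity)
  have hle : √(δ ^ 2 + t ^ 2) ≤ 3 / 2 * δ := by
    apply Real.sqrt_le_iff.2
    constructor
    · positivity
    · nlinarith
  have h3 : √(δ ^ 2 + t ^ 2) ^ 3 ≤ (3 / 2 * δ) ^ 3 := pow_le_pow_left₀ hpos.le hle 3
  rw [div_le_div_iff₀ (by positivity) (by positivity)]
  nlinarith [pow_pos hδ 3]

theorem laplacian_sqrt_inner_nonneg {δ d : ℝ} (hδ : 0 < δ) {a x : F} (ha : ‖a‖ = 1) :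
    0 ≤ Δ (fun y : F => √(δ ^ 2 + (⟪y, a⟫_ℝ - d) ^ 2)) x := by
  rw [laplacian_sqrt_inner hδ ha]
  positivity

omit [FiniteDimensional ℝ F] in
theorem contDiff_sqrt_inner {δ d : ℝ} (hδ : 0 < δ) (a : F) :
    ContDiff ℝ 2 fun y : F => √(δ ^ 2 + (⟪y, a⟫_ℝ - d) ^ 2) :=
  (contDiff_sqrt_add_sq hδ).comp ((contDiff_id.inner ℝ contDiff_const).sub contDiff_const)

end Barriers

section MovingPlanes

variable {F : Type*} [NormedAddCommGroup F] [InnerProductSpace ℝ F]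

/-- Half of `1 + ‖x‖ ^ 2`, the reciprocal of the conformal factor of stereographic projection. -/
noncomputable def confDenom (x : F) : ℝ := (1 + ‖x‖ ^ 2) / 2

omit [InnerProductSpace ℝ F] in
theorem confDenom_pos (x : F) : 0 < confDenom x := by unfold confDenom; positivity

/-- Reflection in the hyperplane `⟪x, a⟫ = l`. -/
noncomputable def planeRefl (a : F) (l : ℝ) (x : F) : F := x + (2 * (l - ⟪x, a⟫_ℝ)) • a

theorem inner_planeRefl {a : F} (ha : ‖a‖ = 1) (l : ℝ) (x : F) :
    ⟪planeRefl a l x, a⟫_ℝ = 2 * l - ⟪x, a⟫_ℝ := by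
  simp [planeRefl, inner_add_left, inner_smul_left, ha]; ring

theorem inner_planeRefl_of_orthogonal {a p : F} (hap : ⟪a, p⟫_ℝ = 0) (l : ℝ) (x : F) :
    ⟪planeRefl a l x, p⟫_ℝ = ⟪x, p⟫_ℝ := by
  simp [planeRefl, inner_add_left, inner_smul_left, hap]

theorem normSq_planeRefl {a : F} (ha : ‖a‖ = 1) (l : ℝ) (x : F) :
    ‖planeRefl a l x‖ ^ 2 = ‖x‖ ^ 2 + 4 * l * (l - ⟪x, a⟫_ℝ) := by
  rw [planeRefl, norm_add_sq_real, norm_smul, inner_smul_right, mul_pow, ha]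
  simp [mul_pow]; ring

theorem planeRefl_of_inner_eq {a : F} {l : ℝ} {x : F} (h : ⟪x, a⟫_ℝ = l) :
    planeRefl a l x = x := by simp [planeRefl, h]

theorem continuous_planeRefl (a : F) : Continuous fun q : ℝ × F => planeRefl a q.1 q.2 := by
  unfold planeRefl; fun_prop

theorem contDiff_planeRefl (a : F) (l : ℝ) : ContDiff ℝ 2 (planeRefl a l) := by
  unfold planeRefl
  exact contDiff_id.add ((contDiff_const.mul (contDiff_const.sub
    (contDiff_id.inner ℝ contDiff_const))).smul contDiff_const)

theorem laplacian_comp_planeRefl [FiniteDimensional ℝ F] {a : F} (ha : ‖a‖ = 1) (l : ℝ)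
    {f : F → ℝ} {x : F} (hf : ContDiffAt ℝ 2 f (planeRefl a l x)) :
    Δ (fun y => f (planeRefl a l y)) x = Δ f (planeRefl a l x) := by
  have h : ∀ y, planeRefl a l y = (ℝ ∙ a)ᗮ.reflection y + (2 * l) • a := by
    intro y
    rw [Submodule.reflection_orthogonal_apply, Submodule.reflection_singleton_apply, planeRefl,
      ha, real_inner_comm]
    simp only [RCLike.ofReal_real_eq_id, id_eq, one_pow, div_one]
    module
  simp_rw [h] at hf ⊢
  exact laplacian_comp_affineIsometry _ _ _ _ hf

theorem le_norm_sub_of_inner {a p : F} (ha : ‖a‖ = 1) (hap : ⟪a, p⟫_ℝ = 0) (x : F) :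
    ⟪x, a⟫_ℝ ≤ ‖x - p‖ ∧ ⟪x, a⟫_ℝ ≤ ‖x + p‖ := by
  have hpa : ⟪p, a⟫_ℝ = 0 := by rw [real_inner_comm]; exact hap
  constructor
  · have := real_inner_le_norm (x - p) a
    simpa [inner_sub_left, hpa, ha] using this
  · have := real_inner_le_norm (x + p) a
    simpa [inner_add_left, hpa, ha] using this

theorem ne_of_inner_pos {a p : F} (hap : ⟪a, p⟫_ℝ = 0) {x : F} (hx : 0 < ⟪x, a⟫_ℝ) :
    x ≠ p ∧ x ≠ -p := by
  have hpa : ⟪p, a⟫_ℝ = 0 := by rw [real_inner_comm]; exact hap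
  constructor
  · rintro rfl; linarith
  · rintro rfl; simp [hpa] at hx

theorem abs_inner_lt_confDenom {p x : F} (hp : ‖p‖ = 1) (h1 : x ≠ p) (h2 : x ≠ -p) :
    |⟪x, p⟫_ℝ| < confDenom x := by
  have e1 := norm_sub_sq_real x p
  have e2 := norm_add_sq_real x p
  have p1 : 0 < ‖x - p‖ := norm_pos_iff.2 (sub_ne_zero.2 h1)
  have p2 : 0 < ‖x + p‖ := norm_pos_iff.2 (by rwa [← sub_neg_eq_add, sub_ne_zero])
  rw [hp] at e1 e2
  unfold confDenom
  rw [abs_lt]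
  constructor <;> nlinarith [pow_pos p1 2, pow_pos p2 2]

/-- The monotonicity assumptions on the rescaled nonlinearity `H t s = s ^ (-P) * G t s`. -/
structure NonlinAdm (H : ℝ → ℝ → ℝ) : Prop where
  anti : ∀ t ∈ Set.Ioo (-1 : ℝ) 1, AntitoneOn (H t) (Set.Ioi 0)
  mono_pos : ∀ s : ℝ, 0 < s → ∀ t t' : ℝ, t < 1 → t' < t → 0 < t' → H t' s ≤ H t s
  mono_neg : ∀ s : ℝ, 0 < s → ∀ t t' : ℝ, -1 < t → t < t' → t' < 0 → H t' s ≤ H t s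
  strict : ((∀ s : ℝ, 0 < s → ∀ t t' : ℝ, t < 1 → t' < t → 0 < t' → H t' s < H t s) ∧
      (∀ s : ℝ, 0 < s → ∀ t t' : ℝ, -1 < t → t < t' → t' < 0 → H t' s < H t s)) ∨
    ∀ t ∈ Set.Ioo (-1 : ℝ) 1, StrictAntiOn (H t) (Set.Ioi 0)
  cont : ∀ t ∈ Set.Ioo (-1 : ℝ) 1, ContinuousOn (H t) (Set.Ioi 0)

theorem NonlinAdm.neg {H : ℝ → ℝ → ℝ} (hH : NonlinAdm H) : NonlinAdm fun t => H (-t) where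
  anti t ht := hH.anti (-t) ⟨by linarith [ht.2], by linarith [ht.1]⟩
  mono_pos s hs t t' h1 h2 h3 :=
    hH.mono_neg s hs (-t) (-t') (by linarith) (by linarith) (by linarith)
  mono_neg s hs t t' h1 h2 h3 :=
    hH.mono_pos s hs (-t) (-t') (by linarith) (by linarith) (by linarith)
  strict := hH.strict.imp
    (fun h => ⟨fun s hs t t' h1 h2 h3 =>
        h.2 s hs (-t) (-t') (by linarith) (by linarith) (by linarith),
      fun s hs t t' h1 h2 h3 => h.1 s hs (-t) (-t') (by linarith) (by linarith) (by linarith)⟩)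
    (fun h t ht => h (-t) ⟨by linarith [ht.2], by linarith [ht.1]⟩)
  cont t ht := hH.cont (-t) ⟨by linarith [ht.2], by linarith [ht.1]⟩

theorem NonlinAdm.div_le {H : ℝ → ℝ → ℝ} (hH : NonlinAdm H) {q M M' s : ℝ} (hq : |q| < M)
    (hM : M ≤ M') (hs : 0 < s) : H (q / M') s ≤ H (q / M) s := by
  have hM0 : 0 < M := (abs_nonneg q).trans_lt hq
  rcases hM.eq_or_lt with rfl | hlt
  · rfl
  rcases lt_trichotomy q 0 with h | rfl | h
  · refine hH.mono_neg s hs _ _ ?_ ?_ (div_neg_of_neg_of_pos h (hM0.trans hlt))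
    · rw [lt_div_iff₀ hM0]; linarith [neg_abs_le q]
    · rw [div_lt_div_iff₀ hM0 (hM0.trans hlt)]; nlinarith
  · simp
  · refine hH.mono_pos s hs _ _ ?_ ?_ (div_pos h (hM0.trans hlt))
    · rw [div_lt_one hM0]; linarith [le_abs_self q]
    · exact div_lt_div_of_pos_left h hM0 hlt

theorem div_mem_Ioo {q M : ℝ} (hq : |q| < M) : q / M ∈ Set.Ioo (-1 : ℝ) 1 := by
  have hM0 : 0 < M := (abs_nonneg q).trans_lt hq
  constructor
  · rw [lt_div_iff₀ hM0]; linarith [neg_abs_le q]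
  · rw [div_lt_one hM0]; linarith [le_abs_self q]

theorem NonlinAdm.conf_le {H : ℝ → ℝ → ℝ} (hH : NonlinAdm H) {q M M' s k : ℝ} (hq : |q| < M)
    (hM : M ≤ M') (hs : 0 < s) (hk : 0 < k) :
    H (q / M') (M' ^ k * s) ≤ H (q / M) (M ^ k * s) := by
  have hM0 : 0 < M := (abs_nonneg q).trans_lt hq
  have hM0' : 0 < M' := hM0.trans_le hM
  refine (hH.div_le hq hM (by positivity)).trans
    (hH.anti _ (div_mem_Ioo hq) (Set.mem_Ioi.2 (by positivity)) (Set.mem_Ioi.2 (by positivity)) ?_)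
  gcongr

theorem NonlinAdm.conf_lt {H : ℝ → ℝ → ℝ} (hH : NonlinAdm H) {q M M' s k : ℝ} (hq : |q| < M)
    (hM : M < M') (hs : 0 < s) (hk : 0 < k) (hq0 : q ≠ 0) :
    H (q / M') (M' ^ k * s) < H (q / M) (M ^ k * s) := by
  have hM0 : 0 < M := (abs_nonneg q).trans_lt hq
  have hM0' : 0 < M' := hM0.trans hM
  have hlt : M ^ k * s < M' ^ k * s := by gcongr
  rcases hH.strict with ⟨hp, hn⟩ | hst
  · refine lt_of_lt_of_le ?_ (hH.anti _ (div_mem_Ioo hq) (Set.mem_Ioi.2 (by positivity))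
      (Set.mem_Ioi.2 (by positivity)) hlt.le)
    rcases hq0.lt_or_gt with h | h
    · refine hn _ (by positivity) _ _ ?_ ?_ (div_neg_of_neg_of_pos h hM0')
      · rw [lt_div_iff₀ hM0]; linarith [neg_abs_le q]
      · rw [div_lt_div_iff₀ hM0 hM0']; nlinarith
    · refine hp _ (by positivity) _ _ ?_ ?_ (div_pos h hM0')
      · rw [div_lt_one hM0]; linarith [le_abs_self q]
      · exact div_lt_div_of_pos_left h hM0 hM
  · exact (hH.div_le hq hM.le (by positivity)).trans_lt
      (hst _ (div_mem_Ioo hq) (Set.mem_Ioi.2 (by positivity)) (Set.mem_Ioi.2 (by positivity)) hlt)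

/-- A positive solution of the stereographically projected equation, singular at most at the two
antipodal unit vectors `p` and `-p`. -/
structure ProjSolution [FiniteDimensional ℝ F] (p : F) (k P : ℝ) (H : ℝ → ℝ → ℝ) (u : F → ℝ) :
    Prop where
  norm_pole : ‖p‖ = 1
  dim : 3 ≤ Module.finrank ℝ F
  k_ge : 1 / 2 ≤ k
  one_le_P : 1 ≤ P
  k_mul : k * (P - 1) = 2
  nonlin : NonlinAdm H
  smooth : ∀ x, x ≠ p → x ≠ -p → ContDiffAt ℝ 2 u x
  pos : ∀ x, x ≠ p → x ≠ -p → 0 < u x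
  eqn : ∀ x, x ≠ p → x ≠ -p →
    -(Δ u x) = u x ^ P * H (⟪x, p⟫_ℝ / confDenom x) (confDenom x ^ k * u x)
  bdd : ∀ r : ℝ, 0 < r → ∃ c C B : ℝ, 0 < c ∧ 0 ≤ B ∧ ∀ x, r ≤ ‖x - p‖ → r ≤ ‖x + p‖ →
    c ≤ confDenom x ^ k * u x ∧ confDenom x ^ k * u x ≤ C ∧ -(Δ u x) ≤ B * u x ^ P
  pole : ∃ c r : ℝ, 0 < c ∧ 0 < r ∧ ∀ x, x ≠ p → x ≠ -p → (‖x - p‖ < r ∨ ‖x + p‖ < r) → c ≤ u x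

omit [InnerProductSpace ℝ F] in
theorem ne_of_le_norm {p x : F} {r : ℝ} (hr : 0 < r) (h1 : r ≤ ‖x - p‖) (h2 : r ≤ ‖x + p‖) :
    x ≠ p ∧ x ≠ -p := by
  constructor
  · rintro rfl; simp at h1; linarith
  · rintro rfl; simp at h2; linarith

namespace ProjSolution

variable [FiniteDimensional ℝ F] {p a : F} {k P : ℝ} {H : ℝ → ℝ → ℝ} {u : F → ℝ}

theorem neg (hu : ProjSolution p k P H u) : ProjSolution (-p) k P (fun t => H (-t)) u where
  norm_pole := by rw [norm_neg, hu.norm_pole]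
  dim := hu.dim
  k_ge := hu.k_ge
  one_le_P := hu.one_le_P
  k_mul := hu.k_mul
  nonlin := hu.nonlin.neg
  smooth x h1 h2 := hu.smooth x (by simpa using h2) h1
  pos x h1 h2 := hu.pos x (by simpa using h2) h1
  eqn x h1 h2 := by
    rw [hu.eqn x (by simpa using h2) h1, inner_neg_right, neg_div, neg_neg]
  bdd r hr := by
    obtain ⟨c, C, B, hc, hB, h⟩ := hu.bdd r hr
    exact ⟨c, C, B, hc, hB, fun x h1 h2 => h x (by rwa [← sub_eq_add_neg] at h2) (by rwa [sub_neg_eq_add] at h1)⟩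
  pole := by
    obtain ⟨c, r, hc, hr, h⟩ := hu.pole
    refine ⟨c, r, hc, hr, fun x h1 h2 h3 => h x (by simpa using h2) h1 ?_⟩
    rwa [sub_neg_eq_add, ← sub_eq_add_neg, or_comm] at h3

theorem k_pos (hu : ProjSolution p k P H u) : 0 < k := by linarith [hu.k_ge]

/-- Difference between the reflected and the original solution. -/
theorem contDiffAt_diff (hu : ProjSolution p k P H u) (hap : ⟪a, p⟫_ℝ = 0) (ha : ‖a‖ = 1) {l : ℝ}
    (hl : 0 < l) {x : F} (hx : ⟪x, a⟫_ℝ ≤ l) (h1 : x ≠ p) (h2 : x ≠ -p) :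
    ContDiffAt ℝ 2 (fun y => u (planeRefl a l y)) x ∧ ContDiffAt ℝ 2 u x := by
  have hne := ne_of_inner_pos (x := planeRefl a l x) hap (by rw [inner_planeRefl ha]; linarith)
  exact ⟨(hu.smooth _ hne.1 hne.2).comp x (contDiff_planeRefl a l).contDiffAt, hu.smooth x h1 h2⟩

theorem laplacian_diff (hu : ProjSolution p k P H u) (hap : ⟪a, p⟫_ℝ = 0) (ha : ‖a‖ = 1) {l : ℝ}
    (hl : 0 < l) {x : F} (hx : ⟪x, a⟫_ℝ ≤ l) (h1 : x ≠ p) (h2 : x ≠ -p) :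
    Δ (fun y => u (planeRefl a l y) - u y) x = Δ u (planeRefl a l x) - Δ u x := by
  have hne := ne_of_inner_pos (x := planeRefl a l x) hap (by rw [inner_planeRefl ha]; linarith)
  obtain ⟨c1, c2⟩ := hu.contDiffAt_diff hap ha hl hx h1 h2
  rw [laplacian_fun_sub c1 c2, laplacian_comp_planeRefl ha l (hu.smooth _ hne.1 hne.2)]

omit [FiniteDimensional ℝ F] in
theorem confDenom_lt {l : ℝ} (ha : ‖a‖ = 1) (hl : 0 < l) {x : F} (hx : ⟪x, a⟫_ℝ < l) :
    confDenom x < confDenom (planeRefl a l x) := by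
  unfold confDenom
  rw [normSq_planeRefl ha]
  have : 0 < 4 * l * (l - ⟪x, a⟫_ℝ) := mul_pos (by linarith) (by linarith)
  linarith

/-- One-sided linear differential inequality for the difference, where it is positive. -/
theorem linear_ineq (hu : ProjSolution p k P H u) (hap : ⟪a, p⟫_ℝ = 0) (ha : ‖a‖ = 1) {r : ℝ}
    (hr : 0 < r) : ∃ C₁ : ℝ, 0 ≤ C₁ ∧ ∀ l : ℝ, r ≤ l → ∀ x, ⟪x, a⟫_ℝ < l → r ≤ ‖x - p‖ →
      r ≤ ‖x + p‖ → u x < u (planeRefl a l x) →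
      -(C₁ / (1 + ‖x‖ ^ 2) ^ 2 * (u (planeRefl a l x) - u x)) ≤
        Δ (fun y => u (planeRefl a l y) - u y) x := by
  obtain ⟨c, C, B, hc, hB, hbd⟩ := hu.bdd r hr
  refine ⟨4 * B * P * |C| ^ (P - 1), ?_, ?_⟩
  · have := hu.one_le_P
    positivity
  intro l hl x hx h1 h2 hlt
  have hl0 : 0 < l := hr.trans_le hl
  obtain ⟨n1, n2⟩ := ne_of_le_norm hr h1 h2
  have hin := inner_planeRefl ha l x
  have hR := le_norm_sub_of_inner (x := planeRefl a l x) ha hap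
  have hne := ne_of_inner_pos (x := planeRefl a l x) hap (by rw [hin]; linarith)
  rw [hu.laplacian_diff hap ha hl0 hx.le n1 n2]
  obtain ⟨-, -, hBx⟩ := hbd x h1 h2
  obtain ⟨-, hCR, -⟩ := hbd (planeRefl a l x) (by linarith [hR.1]) (by linarith [hR.2])
  have e1 := hu.eqn x n1 n2
  have e2 := hu.eqn _ hne.1 hne.2
  rw [inner_planeRefl_of_orthogonal hap] at e2
  have hq := abs_inner_lt_confDenom hu.norm_pole n1 n2
  have hMM := confDenom_lt ha hl0 hx
  have hU := hu.pos _ hne.1 hne.2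
  have hV := hu.pos _ n1 n2
  have hk := hu.k_pos
  have hP := hu.one_le_P
  set U := u (planeRefl a l x)
  set V := u x
  have hM := confDenom_pos x
  have hMdef : 1 + ‖x‖ ^ 2 = 2 * confDenom x := by unfold confDenom; ring
  rw [hMdef]
  set M := confDenom x
  set M' := confDenom (planeRefl a l x)
  set q := ⟪x, p⟫_ℝ
  have i1 : H (q / M') (M' ^ k * U) ≤ H (q / M) (M ^ k * U) :=
    hu.nonlin.conf_le hq hMM.le hU hk
  have i2 : H (q / M) (M ^ k * U) ≤ H (q / M) (M ^ k * V) :=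
    hu.nonlin.anti _ (div_mem_Ioo hq) (Set.mem_Ioi.2 (by positivity))
      (Set.mem_Ioi.2 (by positivity)) (by gcongr)
  have hVP : 0 < V ^ P := Real.rpow_pos_of_pos hV P
  have hUP : 0 < U ^ P := Real.rpow_pos_of_pos hU P
  have hVU : V ^ P ≤ U ^ P := Real.rpow_le_rpow hV.le hlt.le (by linarith)
  have i3 : H (q / M) (M ^ k * V) ≤ B := by
    rw [e1] at hBx
    have : V ^ P * H (q / M) (M ^ k * V) ≤ V ^ P * B := by linarith
    exact le_of_mul_le_mul_left this hVP
  set h0 := H (q / M) (M ^ k * V)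
  set h1 := H (q / M) (M ^ k * U)
  set h2 := H (q / M') (M' ^ k * U)
  have s1 : U ^ P * h2 ≤ U ^ P * h1 := mul_le_mul_of_nonneg_left i1 hUP.le
  have s2 : V ^ P * h1 ≤ V ^ P * h0 := mul_le_mul_of_nonneg_left i2 hVP.le
  have s3 : (U ^ P - V ^ P) * h1 ≤ (U ^ P - V ^ P) * B :=
    mul_le_mul_of_nonneg_left (i2.trans i3) (by linarith)
  have s4 : U ^ P - V ^ P ≤ P * U ^ (P - 1) * (U - V) := by
    have hb := one_add_mul_self_le_rpow_one_add (s := V / U - 1) (by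
      have : 0 < V / U := by positivity
      linarith) hP
    have e : 1 + (V / U - 1) = V / U := by ring
    rw [e, Real.div_rpow hV.le hU.le, le_div_iff₀ hUP] at hb
    have e3 : U ^ (P - 1) * U = U ^ P := by
      rw [← Real.rpow_add_one hU.ne']; congr 1; ring
    have : (1 + P * (V / U - 1)) * U ^ P = U ^ P - P * U ^ (P - 1) * (U - V) := by
      rw [← e3]; field_simp; ring
    linarith
  have s5 : U ^ (P - 1) ≤ |C| ^ (P - 1) / M ^ 2 := by
    have hMU : M ^ k * U ≤ |C| := by
      refine le_trans ?_ (hCR.trans (le_abs_self C))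
      gcongr
    have := Real.rpow_le_rpow (by positivity) hMU (show 0 ≤ P - 1 by linarith)
    rw [Real.mul_rpow (by positivity) hU.le, ← Real.rpow_mul hM.le, hu.k_mul] at this
    rw [le_div_iff₀ (by positivity)]
    have e : M ^ (2 : ℝ) = M ^ 2 := by norm_cast
    rw [e] at this
    linarith
  have s6 : (U ^ P - V ^ P) * B ≤ (P * (|C| ^ (P - 1) / M ^ 2) * (U - V)) * B := by
    refine mul_le_mul_of_nonneg_right (s4.trans ?_) hB
    have : 0 < U - V := by linarith
    gcongr
  have e4 : 4 * B * P * |C| ^ (P - 1) / (2 * M) ^ 2 * (U - V) =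
      (P * (|C| ^ (P - 1) / M ^ 2) * (U - V)) * B := by field_simp; ring
  rw [e4]
  linarith

/-- Growth control of the reflected solution at infinity. -/
theorem refl_le (hu : ProjSolution p k P H u) (hap : ⟪a, p⟫_ℝ = 0) (ha : ‖a‖ = 1) {r : ℝ}
    (hr : 0 < r) : ∃ C : ℝ, 0 < C ∧ ∀ l, r ≤ l → ∀ x, ⟪x, a⟫_ℝ ≤ l →
      u (planeRefl a l x) ≤ C * confDenom (planeRefl a l x) ^ (-k) := by
  obtain ⟨c, C, B, hc, -, hbd⟩ := hu.bdd r hr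
  refine ⟨|C| + 1, by positivity, fun l hl x hx => ?_⟩
  have hin := inner_planeRefl ha l x
  have hR := le_norm_sub_of_inner (x := planeRefl a l x) ha hap
  obtain ⟨-, h, -⟩ := hbd (planeRefl a l x) (by linarith [hR.1]) (by linarith [hR.2])
  have hM := confDenom_pos (planeRefl a l x)
  have hMk : 0 < confDenom (planeRefl a l x) ^ k := by positivity
  rw [Real.rpow_neg hM.le, ← div_eq_mul_inv, le_div_iff₀ hMk]
  linarith [le_abs_self C]

omit [FiniteDimensional ℝ F] in
theorem far_of_band (hp : ‖p‖ = 1) (hap : ⟪a, p⟫_ℝ = 0) (ha : ‖a‖ = 1) {x : F} {r : ℝ}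
    (hr : r ≤ 1 / 2)
    (h : 4 ≤ ‖x‖ ^ 2 ∨ |⟪x, p⟫_ℝ| < 1 / 2 ∨ r ≤ ⟪x, a⟫_ℝ) : r ≤ ‖x - p‖ ∧ r ≤ ‖x + p‖ := by
  rcases h with h | h | h
  · have h2 : 2 ≤ ‖x‖ := by nlinarith [norm_nonneg x]
    have e1 := norm_sub_norm_le x p
    have e2 := norm_sub_norm_le x (-p)
    rw [norm_neg, sub_neg_eq_add] at e2
    constructor <;> linarith
  · have hpp : ⟪p, p⟫_ℝ = 1 := by rw [real_inner_self_eq_norm_sq, hp]; norm_num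
    have e1 := abs_real_inner_le_norm (x - p) p
    have e2 := abs_real_inner_le_norm (x + p) p
    rw [inner_sub_left, hp, hpp, mul_one] at e1
    rw [inner_add_left, hp, hpp, mul_one] at e2
    obtain ⟨h3, h4⟩ := abs_lt.1 h
    constructor
    · linarith [neg_abs_le (⟪x, p⟫_ℝ - 1)]
    · linarith [le_abs_self (⟪x, p⟫_ℝ + 1)]
  · have := le_norm_sub_of_inner (p := p) (x := x) ha hap
    constructor <;> linarith [this.1, this.2]

set_option maxHeartbeats 2000000 in
/-- If the reflected solution can exceed the solution only far away or in narrow bands around the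
hyperplanes `⟪x, p⟫ = 0` and `⟪x, a⟫ = m`, then it does not exceed it at all. -/
theorem refl_le_of_narrow (hu : ProjSolution p k P H u) (hap : ⟪a, p⟫_ℝ = 0) (ha : ‖a‖ = 1)
    {r l m δ κ Q C₁ : ℝ} (hr0 : 0 < r) (hr : r ≤ 1 / 2) (hrl : r ≤ l) (hlm : l ≤ m)
    (hrm : r ≤ m - δ) (hδ : 0 < δ) (hδ2 : δ ≤ 1 / 2) (hκ : 0 < κ) (hQ : 1 ≤ Q) (hC : 0 ≤ C₁)
    (hlin : ∀ x, ⟪x, a⟫_ℝ < l → r ≤ ‖x - p‖ →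
      r ≤ ‖x + p‖ → u x < u (planeRefl a l x) →
      -(C₁ / (1 + ‖x‖ ^ 2) ^ 2 * (u (planeRefl a l x) - u x)) ≤
        Δ (fun y => u (planeRefl a l y) - u y) x)
    (hCQ : 16 * C₁ < Q) (hCκ : C₁ < κ * (1 / (4 * δ)))
    (hsmall : ∀ x : F, 1 + ‖x‖ ^ 2 ≤ 16 * Q →
      κ * (√(δ ^ 2 + (⟪x, a⟫_ℝ - m) ^ 2) + √(δ ^ 2 + (⟪x, p⟫_ℝ - 0) ^ 2)) < 1 / 2)
    (hneg : ∀ x, ⟪x, a⟫_ℝ < l → x ≠ p → x ≠ -p → 1 + ‖x‖ ^ 2 ≤ 16 * Q → δ ≤ |⟪x, p⟫_ℝ| →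
      ⟪x, a⟫_ℝ ≤ m - δ → u (planeRefl a l x) ≤ u x) :
    ∀ x, ⟪x, a⟫_ℝ < l → x ≠ p → x ≠ -p → u (planeRefl a l x) ≤ u x := by
  have hl0 : 0 < l := hr0.trans_le hrl
  by_contra! hcon
  obtain ⟨x₀, hx₀, hx₀1, hx₀2, hlt₀⟩ := hcon
  set w : F → ℝ := fun y => u (planeRefl a l y) - u y with hw
  set h1 : F → ℝ := fun y =>
    1 - κ * (√(δ ^ 2 + (⟪y, a⟫_ℝ - m) ^ 2) + √(δ ^ 2 + (⟪y, p⟫_ℝ - 0) ^ 2)) with hh1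
  set h2 : F → ℝ := fun y => Q ^ (1 / 4 : ℝ) * (1 + ‖y‖ ^ 2) ^ (-(1 / 4) : ℝ) with hh2
  set h : F → ℝ := fun y => min (max (h1 y) (1 / 2)) (h2 y) with hh
  have hQ0 : 0 < Q := by linarith
  have hpos1 : ∀ y : F, 0 < 1 + ‖y‖ ^ 2 := fun y => by positivity
  have h2pos : ∀ y, 0 < h2 y := fun y => by
    have := hpos1 y
    positivity
  have hpos : ∀ y, 0 < h y := fun y => lt_min (lt_max_of_lt_right (by norm_num)) (h2pos y)
  have h1smooth : ∀ y, ContDiffAt ℝ 2 h1 y := fun y =>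
    contDiffAt_const.sub (contDiffAt_const.mul
      ((contDiff_sqrt_inner hδ a).contDiffAt.add (contDiff_sqrt_inner hδ p).contDiffAt))
  have h2smooth : ∀ y, ContDiffAt ℝ 2 h2 y := fun y =>
    contDiffAt_const.mul (contDiffAt_rpow_normSq (hpos1 y))
  have h1cont : Continuous h1 := continuous_iff_continuousAt.2 fun y => (h1smooth y).continuousAt
  have h2cont : Continuous h2 := continuous_iff_continuousAt.2 fun y => (h2smooth y).continuousAt
  have hcont : Continuous h := (h1cont.max continuous_const).min h2cont
  have h1lt : ∀ y, h1 y < 1 := fun y => by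
    have : 0 < √(δ ^ 2 + (⟪y, a⟫_ℝ - m) ^ 2) := Real.sqrt_pos.2 (by positivity)
    have : 0 ≤ √(δ ^ 2 + (⟪y, p⟫_ℝ - 0) ^ 2) := Real.sqrt_nonneg _
    simp only [hh1]
    have : 0 < κ * (√(δ ^ 2 + (⟪y, a⟫_ℝ - m) ^ 2) + √(δ ^ 2 + (⟪y, p⟫_ℝ - 0) ^ 2)) := by
      positivity
    linarith
  have h2eq : ∀ y, h2 y = (Q / (1 + ‖y‖ ^ 2)) ^ (1 / 4 : ℝ) := fun y => by
    simp only [hh2]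
    rw [Real.div_rpow hQ0.le (hpos1 y).le, Real.rpow_neg (hpos1 y).le]
    exact (div_eq_mul_inv _ _).symm
  have h2_ge : ∀ y, h2 y < 1 → Q < 1 + ‖y‖ ^ 2 := fun y hy => by
    by_contra! hc
    rw [h2eq] at hy
    have : 1 ≤ Q / (1 + ‖y‖ ^ 2) := by rwa [le_div_iff₀ (hpos1 y), one_mul]
    linarith [Real.one_le_rpow this (show (0:ℝ) ≤ 1 / 4 by norm_num)]
  have h2_half : ∀ y, 16 * Q ≤ 1 + ‖y‖ ^ 2 → h2 y ≤ 1 / 2 := fun y hy => by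
    rw [h2eq]
    have e : (1 / 2 : ℝ) = (1 / 16 : ℝ) ^ (1 / 4 : ℝ) := by
      rw [show (1 / 16 : ℝ) = (1 / 2) ^ (4 : ℝ) by norm_num, ← Real.rpow_mul (by norm_num)]
      norm_num
    rw [e]
    apply Real.rpow_le_rpow (by have := hpos1 y; positivity) _ (by norm_num)
    rw [div_le_iff₀ (hpos1 y)]; linarith
  -- the difference can be positive only away from the poles
  have hfar : ∀ x, ⟪x, a⟫_ℝ < l → x ≠ p → x ≠ -p → 0 < w x →
      (16 * Q < 1 + ‖x‖ ^ 2 ∨ |⟪x, p⟫_ℝ| < δ ∨ m - δ < ⟪x, a⟫_ℝ) := by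
    intro x hx n1 n2 hwx
    by_contra! hc
    have := hneg x hx n1 n2 hc.1 hc.2.1 hc.2.2
    simp only [hw] at hwx
    linarith
  have hfar' : ∀ x, ⟪x, a⟫_ℝ < l → x ≠ p → x ≠ -p → 0 < w x → r ≤ ‖x - p‖ ∧ r ≤ ‖x + p‖ := by
    intro x hx n1 n2 hwx
    refine far_of_band hu.norm_pole hap ha hr ?_
    rcases hfar x hx n1 n2 hwx with h | h | h
    · left; linarith
    · right; left; linarith
    · right; right; linarith
  set φ : F → ℝ := fun y => w y / h y with hφ
  have hφ₀ : 0 < φ x₀ := div_pos (by simp only [hw]; linarith) (hpos _)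
  -- decay at infinity
  obtain ⟨L, hL0, hLx, hL⟩ : ∃ L : ℝ, 0 < L ∧ ‖x₀‖ < L ∧
      ∀ x, ⟪x, a⟫_ℝ ≤ l → x ≠ p → x ≠ -p → L ≤ ‖x‖ → φ x < φ x₀ := by
    obtain ⟨C, hC0, hCb⟩ := hu.refl_le hap ha hr0
    have hlim : Tendsto (fun L : ℝ => C / Q ^ (1 / 4 : ℝ) * 4 * L ^ (-(1 / 2) : ℝ)) atTop (𝓝 0) := by
      simpa using (tendsto_rpow_neg_atTop (y := 1 / 2) (by norm_num)).const_mul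
        (C / Q ^ (1 / 4 : ℝ) * 4)
    obtain ⟨L, hLa, hLb⟩ := ((hlim.eventually (gt_mem_nhds hφ₀)).and
      (eventually_ge_atTop (‖x₀‖ + 16 * Q + 1))).exists
    have hn0 := norm_nonneg x₀
    have hL1 : 1 ≤ L := by linarith
    refine ⟨L, by linarith, by linarith, fun x hx n1 n2 hxL => lt_of_le_of_lt ?_ hLa⟩
    have hx16 : 16 * Q ≤ 1 + ‖x‖ ^ 2 := by nlinarith
    have hhx : h x = h2 x := min_eq_right ((h2_half x hx16).trans (le_max_right _ _))
    have hux := hu.pos x n1 n2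
    have hwle : w x ≤ C * confDenom x ^ (-k) := by
      have b1 := hCb l hrl x hx
      have b2 : confDenom (planeRefl a l x) ^ (-k) ≤ confDenom x ^ (-k) := by
        apply Real.rpow_le_rpow_of_nonpos (confDenom_pos x) _ (by linarith [hu.k_pos])
        rcases hx.eq_or_lt with he | hlt
        · rw [planeRefl_of_inner_eq he]
        · exact (confDenom_lt ha hl0 hlt).le
      have b3 := mul_le_mul_of_nonneg_left b2 hC0.le
      simp only [hw]; linarith
    simp only [hφ]
    rw [hhx, div_le_iff₀ (h2pos x)]
    refine hwle.trans ?_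
    have hM1 : 1 ≤ confDenom x := by unfold confDenom; nlinarith
    have hM0 : 0 < confDenom x := by linarith
    have c1 : confDenom x ^ (-k) ≤ confDenom x ^ (-(1 / 2) : ℝ) :=
      Real.rpow_le_rpow_of_exponent_le hM1 (by linarith [hu.k_ge])
    have hxpos : 0 < ‖x‖ := by linarith
    have c2 : confDenom x ^ (-(1 / 2) : ℝ) =
        confDenom x ^ (-(1 / 4) : ℝ) * confDenom x ^ (-(1 / 4) : ℝ) := by
      rw [← Real.rpow_add hM0]; norm_num
    have c3 : confDenom x ^ (-(1 / 4) : ℝ) ≤ 2 * (1 + ‖x‖ ^ 2) ^ (-(1 / 4) : ℝ) := by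
      have : confDenom x = (1 / 2) * (1 + ‖x‖ ^ 2) := by unfold confDenom; ring
      rw [this, Real.mul_rpow (by norm_num) (hpos1 x).le]
      gcongr
      rw [Real.rpow_neg (by norm_num), ← Real.inv_rpow (by norm_num)]
      have := Real.rpow_le_rpow_of_exponent_le (x := (1 / 2 : ℝ)⁻¹) (by norm_num)
        (show (1 / 4 : ℝ) ≤ 1 by norm_num)
      norm_num at this ⊢
      linarith
    have c4 : (1 + ‖x‖ ^ 2) ^ (-(1 / 4) : ℝ) ≤ L ^ (-(1 / 2) : ℝ) := by
      have : L ^ (-(1 / 2) : ℝ) = (L ^ 2) ^ (-(1 / 4) : ℝ) := by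
        rw [← Real.rpow_natCast L 2, ← Real.rpow_mul (by linarith)]; norm_num
      rw [this]
      apply Real.rpow_le_rpow_of_nonpos (by positivity) _ (by norm_num)
      nlinarith
    have hA : 0 < (1 + ‖x‖ ^ 2) ^ (-(1 / 4) : ℝ) := Real.rpow_pos_of_pos (hpos1 x) _
    have hB : 0 < L ^ (-(1 / 2) : ℝ) := Real.rpow_pos_of_pos (by linarith) _
    have hD : 0 < confDenom x ^ (-(1 / 4) : ℝ) := Real.rpow_pos_of_pos hM0 _
    have hQq : 0 < Q ^ (1 / 4 : ℝ) := Real.rpow_pos_of_pos hQ0 _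
    simp only [hh2]
    set A := (1 + ‖x‖ ^ 2) ^ (-(1 / 4) : ℝ)
    have : C / Q ^ (1 / 4 : ℝ) * 4 * L ^ (-(1 / 2) : ℝ) * (Q ^ (1 / 4 : ℝ) * A) =
        C * (4 * (L ^ (-(1 / 2) : ℝ) * A)) := by field_simp
    rw [this]
    refine mul_le_mul_of_nonneg_left ?_ hC0.le
    rw [c2] at c1
    refine c1.trans ?_
    calc _ ≤ (2 * A) * (2 * A) := mul_le_mul c3 c3 hD.le (by positivity)
      _ = 4 * (A * A) := by ring
      _ ≤ _ := by gcongr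
  -- a maximum point of the quotient
  set D : Set F := {x | ⟪x, a⟫_ℝ ≤ l ∧ r / 2 ≤ ‖x - p‖ ∧ r / 2 ≤ ‖x + p‖ ∧ ‖x‖ ≤ L} with hD
  have hDne : ∀ x ∈ D, x ≠ p ∧ x ≠ -p := fun x hx => ne_of_le_norm (half_pos hr0) hx.2.1 hx.2.2.1
  have hDc : IsCompact D := by
    refine Metric.isCompact_of_isClosed_isBounded ?_ ?_
    · have z1 : IsClosed {x : F | ⟪x, a⟫_ℝ ≤ l} := isClosed_le (by fun_prop) continuous_const
      have z2 : IsClosed {x : F | r / 2 ≤ ‖x - p‖} := isClosed_le continuous_const (by fun_prop)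
      have z3 : IsClosed {x : F | r / 2 ≤ ‖x + p‖} := isClosed_le continuous_const (by fun_prop)
      have z4 : IsClosed {x : F | ‖x‖ ≤ L} := isClosed_le (by fun_prop) continuous_const
      exact z1.inter (z2.inter (z3.inter z4))
    · exact (Metric.isBounded_closedBall (x := (0 : F)) (r := L)).subset fun x hx => by
        simpa using hx.2.2.2
  have hx₀D : x₀ ∈ D := by
    have := hfar' x₀ hx₀ hx₀1 hx₀2 (by simp only [hw]; linarith)
    exact ⟨hx₀.le, by linarith [this.1], by linarith [this.2], hLx.le⟩
  have hwc : ∀ x ∈ D, ContDiffAt ℝ 2 w x := fun x hx => by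
    obtain ⟨c1, c2⟩ := hu.contDiffAt_diff hap ha hl0 hx.1 (hDne x hx).1 (hDne x hx).2
    exact c1.sub c2
  have hφc : ContinuousOn φ D := fun x hx =>
    ((hwc x hx).continuousAt.div hcont.continuousAt (hpos x).ne').continuousWithinAt
  obtain ⟨x₁, hx₁D, hmax⟩ := hDc.exists_isMaxOn ⟨x₀, hx₀D⟩ hφc
  set M := φ x₁ with hM
  have hMge : φ x₀ ≤ M := hmax hx₀D
  have hM0 : 0 < M := hφ₀.trans_le hMge
  have hw₁ : w x₁ = M * h x₁ := by rw [hM]; simp only [hφ]; field_simp [(hpos x₁).ne']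
  have hw₁pos : 0 < w x₁ := by rw [hw₁]; exact mul_pos hM0 (hpos _)
  obtain ⟨n1, n2⟩ := hDne x₁ hx₁D
  have hx₁l : ⟪x₁, a⟫_ℝ < l := by
    refine lt_of_le_of_ne hx₁D.1 fun he => ?_
    simp only [hw, planeRefl_of_inner_eq he, sub_self, lt_self_iff_false] at hw₁pos
  obtain ⟨f1, f2⟩ := hfar' x₁ hx₁l n1 n2 hw₁pos
  have hx₁L : ‖x₁‖ < L := by
    by_contra! hc
    linarith [hL x₁ hx₁D.1 n1 n2 hc]
  have hDnhds : ∀ᶠ y in 𝓝 x₁, y ∈ D := by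
    have t1 : ∀ᶠ y in 𝓝 x₁, ⟪y, a⟫_ℝ < l :=
      (Continuous.tendsto (by fun_prop) x₁).eventually (gt_mem_nhds hx₁l)
    have t2 : ∀ᶠ y in 𝓝 x₁, r / 2 < ‖y - p‖ :=
      (Continuous.tendsto (by fun_prop) x₁).eventually (lt_mem_nhds (by linarith))
    have t3 : ∀ᶠ y in 𝓝 x₁, r / 2 < ‖y + p‖ :=
      (Continuous.tendsto (by fun_prop) x₁).eventually (lt_mem_nhds (by linarith))
    have t4 : ∀ᶠ y in 𝓝 x₁, ‖y‖ < L :=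
      (Continuous.tendsto (by fun_prop) x₁).eventually (gt_mem_nhds hx₁L)
    filter_upwards [t1, t2, t3, t4] with y a b c d using ⟨a.le, b.le, c.le, d.le⟩
  have hwle : ∀ᶠ y in 𝓝 x₁, w y ≤ M * h y := by
    filter_upwards [hDnhds] with y hy
    have : φ y ≤ M := hmax hy
    rwa [hφ, div_le_iff₀ (hpos y)] at this
  have hlow := hlin x₁ hx₁l f1 f2 (by simp only [hw] at hw₁pos; linarith)
  change -(C₁ / (1 + ‖x₁‖ ^ 2) ^ 2 * w x₁) ≤ Δ w x₁ at hlow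
  set q := 1 + ‖x₁‖ ^ 2 with hq
  have hq1 : 1 ≤ q := by rw [hq]; nlinarith [sq_nonneg ‖x₁‖]
  rcases le_or_gt (h2 x₁) (max (h1 x₁) (1 / 2)) with hcase | hcase
  · have heq : h x₁ = h2 x₁ := min_eq_right hcase
    have htouch := laplacian_le_of_touching (h := fun y => M * h2 y) (hwc x₁ hx₁D)
      (contDiffAt_const.mul (h2smooth x₁))
      (by filter_upwards [hwle] with y hy using
            hy.trans (mul_le_mul_of_nonneg_left (min_le_right _ _) hM0.le))
      (by rw [hw₁, heq])
    rw [laplacian_fun_const_mul M (h2smooth x₁)] at htouch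
    have hΔ : Δ h2 x₁ ≤ -(1 / 4) * h2 x₁ / q := by
      have b := laplacian_rpow_neg_quarter_le zero_le_one (hpos1 x₁) hu.dim
      simp only [hh2]
      rw [laplacian_fun_const_mul _ (contDiffAt_rpow_normSq (hpos1 x₁))]
      refine (mul_le_mul_of_nonneg_left b (Real.rpow_nonneg hQ0.le _)).trans (le_of_eq ?_)
      ring
    have hqQ : Q < q := h2_ge x₁ (hcase.trans_lt (max_lt (h1lt _) (by norm_num)))
    have c1 : M * Δ h2 x₁ ≤ -(1 / 4) * w x₁ / q := by
      refine (mul_le_mul_of_nonneg_left hΔ hM0.le).trans (le_of_eq ?_)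
      rw [hw₁, heq]; ring
    have c2 := hlow.trans (htouch.trans c1)
    have c3 : C₁ / q ^ 2 * w x₁ < 1 / 4 * w x₁ / q := by
      rw [div_mul_eq_mul_div, div_lt_div_iff₀ (by positivity) (by positivity)]
      have : C₁ * q < 1 / 4 * q ^ 2 := by nlinarith
      nlinarith
    have c4 : -(1 / 4) * w x₁ / q = -(1 / 4 * w x₁ / q) := by ring
    linarith
  · have hhalf : 1 / 2 < h2 x₁ := (le_max_right _ _).trans_lt hcase
    have hq16 : q < 16 * Q := by
      by_contra! hc
      linarith [h2_half x₁ hc]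
    have hh1x : 1 / 2 < h1 x₁ := by
      have := hsmall x₁ hq16.le
      simp only [hh1]; linarith
    have heq : h x₁ = h1 x₁ := by
      simp only [hh]
      rw [min_eq_left hcase.le, max_eq_left hh1x.le]
    have hnear : ∀ᶠ y in 𝓝 x₁, 1 / 2 < h1 y := (h1cont.tendsto x₁).eventually (lt_mem_nhds hh1x)
    have htouch := laplacian_le_of_touching (h := fun y => M * h1 y) (hwc x₁ hx₁D)
      (contDiffAt_const.mul (h1smooth x₁))
      (by
        filter_upwards [hwle, hnear] with y hy hy2
        refine hy.trans (mul_le_mul_of_nonneg_left ?_ hM0.le)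
        exact (min_le_left _ _).trans (max_eq_left hy2.le).le)
      (by rw [hw₁, heq])
    rw [laplacian_fun_const_mul M (h1smooth x₁)] at htouch
    have hΔ : Δ h1 x₁ < -C₁ := by
      have s1 := (contDiff_sqrt_inner (d := m) hδ a).contDiffAt (x := x₁)
      have s2 := (contDiff_sqrt_inner (d := 0) hδ p).contDiffAt (x := x₁)
      have e : Δ h1 x₁ = -(κ * (Δ (fun y : F => √(δ ^ 2 + (⟪y, a⟫_ℝ - m) ^ 2)) x₁ +
          Δ (fun y : F => √(δ ^ 2 + (⟪y, p⟫_ℝ - 0) ^ 2)) x₁)) := by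
        simp only [hh1]
        rw [laplacian_fun_sub contDiffAt_const (contDiffAt_const.mul (s1.add s2)),
          laplacian_fun_const_mul κ (s1.add s2), laplacian_fun_add s1 s2,
          InnerProductSpace.laplacian_const]
        simp
      rw [e]
      have g1 := laplacian_sqrt_inner_nonneg (d := m) (x := x₁) hδ ha
      have g2 := laplacian_sqrt_inner_nonneg (d := 0) (x := x₁) hδ hu.norm_pole
      have : κ * (1 / (4 * δ)) ≤ κ * (Δ (fun y : F => √(δ ^ 2 + (⟪y, a⟫_ℝ - m) ^ 2)) x₁ +
          Δ (fun y : F => √(δ ^ 2 + (⟪y, p⟫_ℝ - 0) ^ 2)) x₁) := by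
        refine mul_le_mul_of_nonneg_left ?_ hκ.le
        rcases hfar x₁ hx₁l n1 n2 hw₁pos with hf | hf | hf
        · linarith
        · have := inv_le_laplacian_sqrt_inner (d := 0) (x := x₁) hδ hu.norm_pole
            (by rw [sub_zero]; exact hf.le)
          linarith
        · have := inv_le_laplacian_sqrt_inner (d := m) (x := x₁) hδ ha
            (by rw [abs_le]; constructor <;> linarith)
          linarith
      linarith
    have c1 : M * Δ h1 x₁ < -(C₁ * M) := by nlinarith
    have c2 : C₁ / q ^ 2 * w x₁ ≤ C₁ * M := by
      rw [hw₁, heq, div_mul_eq_mul_div]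
      refine (div_le_self ?_ (one_le_pow₀ hq1)).trans ?_
      · have : 0 < h1 x₁ := by linarith
        positivity
      · refine mul_le_mul_of_nonneg_left ?_ hC
        nlinarith [h1lt x₁]
    linarith

/-- Where the solution dominates its reflection, it does so strictly off `⟪x, p⟫ = 0`. -/
theorem refl_lt (hu : ProjSolution p k P H u) (hap : ⟪a, p⟫_ℝ = 0) (ha : ‖a‖ = 1) {l : ℝ}
    (hl : 0 < l) (hle : ∀ x, ⟪x, a⟫_ℝ < l → x ≠ p → x ≠ -p → u (planeRefl a l x) ≤ u x) {x : F}
    (hx : ⟪x, a⟫_ℝ < l) (hxp : ⟪x, p⟫_ℝ ≠ 0) (h1 : x ≠ p) (h2 : x ≠ -p) :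
    u (planeRefl a l x) < u x := by
  refine lt_of_le_of_ne (hle x hx h1 h2) fun heq => ?_
  obtain ⟨c1, c2⟩ := hu.contDiffAt_diff hap ha hl hx.le h1 h2
  have hnear : ∀ᶠ y in 𝓝 x, u (planeRefl a l y) ≤ u y := by
    have t1 : ∀ᶠ y in 𝓝 x, ⟪y, a⟫_ℝ < l :=
      (Continuous.tendsto (by fun_prop) x).eventually (gt_mem_nhds hx)
    filter_upwards [t1, isOpen_ne.mem_nhds h1, isOpen_ne.mem_nhds h2] with y a b c using
      hle y a b c
  have hΔ := laplacian_le_of_touching c1 c2 hnear heq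
  have hne := ne_of_inner_pos (x := planeRefl a l x) hap (by rw [inner_planeRefl ha]; linarith)
  rw [laplacian_comp_planeRefl ha l (hu.smooth _ hne.1 hne.2)] at hΔ
  have e1 := hu.eqn x h1 h2
  have e2 := hu.eqn _ hne.1 hne.2
  rw [inner_planeRefl_of_orthogonal hap, heq] at e2
  have hux := hu.pos x h1 h2
  have := mul_lt_mul_of_pos_left (hu.nonlin.conf_lt (abs_inner_lt_confDenom hu.norm_pole h1 h2)
    (confDenom_lt ha hl hx) hux hu.k_pos hxp) (Real.rpow_pos_of_pos hux P)
  linarith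

omit [FiniteDimensional ℝ F] in
theorem continuousAt_laplacian [FiniteDimensional ℝ F] {x : F} (hf : ContDiffAt ℝ 2 u x) :
    ContinuousAt (Δ u) x := by
  have h : Δ u = fun y => ∑ i, fderiv ℝ (fderiv ℝ u) y (stdOrthonormalBasis ℝ F i)
      (stdOrthonormalBasis ℝ F i) := by
    funext y; exact laplacian_eq_sum_fderiv_fderiv _ _ _
  rw [h]
  have h2 : ContinuousAt (fderiv ℝ (fderiv ℝ u)) x :=
    ((hf.fderiv_right (m := 1) (by norm_num)).fderiv_right (m := 0) (by norm_num)).continuousAt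
  refine tendsto_finsetSum _ fun i _ => ?_
  exact (h2.clm_apply continuousAt_const).clm_apply continuousAt_const

omit [FiniteDimensional ℝ F] in
/-- Lower bound near an isolated singularity for functions superharmonic on a sublevel set. -/
theorem le_of_superharmonic_punctured [FiniteDimensional ℝ F] (hdim : 3 ≤ Module.finrank ℝ F)
    {z : F → ℝ} {r m : ℝ} (hm : 0 < m)
    (hz : ∀ x, x ≠ p → ‖x - p‖ ≤ r → ContDiffAt ℝ 2 z x)
    (hz0 : ∀ x, x ≠ p → ‖x - p‖ ≤ r → 0 ≤ z x) (hzr : ∀ x, ‖x - p‖ = r → m ≤ z x)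
    (hΔ : ∀ x, x ≠ p → ‖x - p‖ ≤ r → z x < m → Δ z x ≤ 0) :
    ∀ x, x ≠ p → ‖x - p‖ ≤ r → m ≤ z x := by
  intro x₀ hx₀ hx₀r
  by_contra! hlt
  have hn0 : 0 < ‖x₀ - p‖ := norm_pos_iff.2 (sub_ne_zero.2 hx₀)
  set g : F → ℝ := fun y => (0 + ‖y‖ ^ 2) ^ (-(1 / 4) : ℝ) with hg
  have hgpos : ∀ y, 0 ≤ g y := fun y => by simp only [hg]; positivity
  obtain ⟨η, hη, hη2⟩ : ∃ η : ℝ, 0 < η ∧ z x₀ + η * g (x₀ - p) < m := by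
    have hd : 0 < g (x₀ - p) + 1 := by linarith [hgpos (x₀ - p)]
    refine ⟨(m - z x₀) / (g (x₀ - p) + 1), div_pos (by linarith) hd, ?_⟩
    have : (m - z x₀) / (g (x₀ - p) + 1) * g (x₀ - p) < m - z x₀ := by
      rw [div_mul_eq_mul_div, div_lt_iff₀ hd]
      exact mul_lt_mul_of_pos_left (by linarith) (by linarith)
    linarith
  have hsm : ∀ x, x ≠ p → ContDiffAt ℝ 2 (fun y => g (y - p)) x := fun x hx => by
    have hx' : 0 < 0 + ‖x - p‖ ^ 2 := by
      have : 0 < ‖x - p‖ := norm_pos_iff.2 (sub_ne_zero.2 hx)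
      positivity
    exact (contDiffAt_rpow_normSq hx').comp (f := fun y => y - p) x
      (contDiffAt_id.sub contDiffAt_const)
  obtain ⟨ρ, hρ, hρm⟩ : ∃ ρ : ℝ, 0 < ρ ∧ ∀ y, 0 < ‖y‖ → ‖y‖ ≤ ρ → m < η * g y := by
    have hc : 0 < (η / (2 * m)) ^ 2 := by positivity
    refine ⟨(η / (2 * m)) ^ 2, hc, fun y hy hyρ => ?_⟩
    have e : g y = ‖y‖ ^ (-(1 / 2) : ℝ) := by
      simp only [hg, zero_add]
      rw [← Real.rpow_natCast ‖y‖ 2, ← Real.rpow_mul hy.le]; norm_num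
    have e2 : ((η / (2 * m)) ^ 2) ^ (-(1 / 2) : ℝ) = 2 * m / η := by
      rw [← Real.rpow_natCast (η / (2 * m)) 2, ← Real.rpow_mul (by positivity)]
      norm_num
      rw [Real.rpow_neg_one, inv_div]
    have e3 : 2 * m / η ≤ g y := by
      rw [e, ← e2]; exact Real.rpow_le_rpow_of_nonpos hy hyρ (by norm_num)
    have e4 := mul_le_mul_of_nonneg_left e3 hη.le
    have e5 : η * (2 * m / η) = 2 * m := by field_simp
    linarith
  set φ : F → ℝ := fun y => z y + η * g (y - p) with hφ
  set D : Set F := {x | ρ ≤ ‖x - p‖ ∧ ‖x - p‖ ≤ r} with hD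
  have hDne : ∀ x ∈ D, x ≠ p := by
    rintro x hx rfl
    have := hx.1
    simp at this; linarith
  have hDc : IsCompact D := by
    refine Metric.isCompact_of_isClosed_isBounded ?_ ?_
    · have z1 : IsClosed {x : F | ρ ≤ ‖x - p‖} := isClosed_le continuous_const (by fun_prop)
      have z2 : IsClosed {x : F | ‖x - p‖ ≤ r} := isClosed_le (by fun_prop) continuous_const
      exact z1.inter z2
    · exact (Metric.isBounded_closedBall (x := p) (r := r)).subset fun x hx => by
        simpa [dist_eq_norm] using hx.2
  have hx₀D : x₀ ∈ D := by
    refine ⟨?_, hx₀r⟩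
    by_contra! hc
    linarith [hρm _ hn0 hc.le, hz0 x₀ hx₀ hx₀r]
  have hφc : ContinuousOn φ D := fun x hx =>
    ((hz x (hDne x hx) hx.2).continuousAt.add
      (continuousAt_const.mul (hsm x (hDne x hx)).continuousAt)).continuousWithinAt
  obtain ⟨x₁, hx₁, hmin⟩ := hDc.exists_isMinOn ⟨x₀, hx₀D⟩ hφc
  have hlt1 : φ x₁ < m := (hmin hx₀D).trans_lt hη2
  have hne := hDne x₁ hx₁
  have hpos : 0 < ‖x₁ - p‖ := norm_pos_iff.2 (sub_ne_zero.2 hne)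
  have hz₁ := hz0 x₁ hne hx₁.2
  have hg₁ : 0 ≤ η * g (x₁ - p) := mul_nonneg hη.le (hgpos _)
  have hi1 : ρ < ‖x₁ - p‖ := by
    by_contra! hc
    have := hρm _ hpos hc
    simp only [hφ] at hlt1
    linarith
  have hi2 : ‖x₁ - p‖ < r := by
    refine lt_of_le_of_ne hx₁.2 fun hc => ?_
    have := hzr _ hc
    simp only [hφ] at hlt1
    linarith
  have hnear : ∀ᶠ y in 𝓝 x₁, φ x₁ - η * g (y - p) ≤ z y := by
    have t2 : ∀ᶠ y in 𝓝 x₁, ρ < ‖y - p‖ :=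
      (Continuous.tendsto (by fun_prop) x₁).eventually (lt_mem_nhds hi1)
    have t3 : ∀ᶠ y in 𝓝 x₁, ‖y - p‖ < r :=
      (Continuous.tendsto (by fun_prop) x₁).eventually (gt_mem_nhds hi2)
    filter_upwards [t2, t3] with y h2 h3
    have : φ x₁ ≤ φ y := hmin (⟨h2.le, h3.le⟩ : y ∈ D)
    simp only [hφ] at this ⊢
    linarith
  have htouch := laplacian_le_of_touching (f := fun y => φ x₁ - η * g (y - p))
    (contDiffAt_const.sub (contDiffAt_const.mul (hsm x₁ hne))) (hz x₁ hne hx₁.2) hnear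
    (by simp only [hφ]; ring)
  rw [laplacian_fun_sub contDiffAt_const (contDiffAt_const.mul (hsm x₁ hne)),
    laplacian_fun_const_mul η (hsm x₁ hne), InnerProductSpace.laplacian_const] at htouch
  have hq : 0 < 0 + ‖x₁ - p‖ ^ 2 := by positivity
  have hgq : ContDiffAt ℝ 2 g (x₁ - p) := contDiffAt_rpow_normSq hq
  have e := laplacian_comp_affineIsometry (LinearIsometryEquiv.refl ℝ F) (-p) g x₁
    (by rwa [LinearIsometryEquiv.coe_refl, id_eq, ← sub_eq_add_neg])
  simp only [LinearIsometryEquiv.coe_refl, id_eq, ← sub_eq_add_neg] at e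
  rw [e] at htouch
  have hb := laplacian_rpow_neg_quarter_le le_rfl hq hdim
  have hneg : -(1 / 4) * (0 + ‖x₁ - p‖ ^ 2) ^ (-(1 / 4) : ℝ) / (0 + ‖x₁ - p‖ ^ 2) < 0 := by
    have : 0 < (0 + ‖x₁ - p‖ ^ 2) ^ (-(1 / 4) : ℝ) := Real.rpow_pos_of_pos hq _
    apply div_neg_of_neg_of_pos _ hq
    linarith
  have hlast := hΔ x₁ hne hx₁.2 (by simp only [hφ] at hlt1; linarith)
  have hfin : η * Δ g (x₁ - p) < 0 := mul_neg_of_pos_of_neg hη (hb.trans_lt hneg)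
  simp at htouch
  linarith

/-- The difference stays away from zero near the singular point. -/
theorem exists_le_sub_near_pole (hu : ProjSolution p k P H u) (hap : ⟪a, p⟫_ℝ = 0) (ha : ‖a‖ = 1)
    {l : ℝ} (hl : 0 < l)
    (hle : ∀ x, ⟪x, a⟫_ℝ < l → x ≠ p → x ≠ -p → u (planeRefl a l x) ≤ u x) :
    ∃ r m : ℝ, 0 < r ∧ 0 < m ∧ ∀ x, x ≠ p → ‖x - p‖ ≤ r → m ≤ u x - u (planeRefl a l x) := by
  have hp := hu.norm_pole
  have hpp : ⟪p, p⟫_ℝ = 1 := by rw [real_inner_self_eq_norm_sq, hp]; norm_num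
  have hpa : ⟪p, a⟫_ℝ = 0 := by rw [real_inner_comm]; exact hap
  have hpl : ⟪p, a⟫_ℝ < l := by rwa [hpa]
  have hNp : confDenom p = 1 := by unfold confDenom; rw [hp]; norm_num
  have hR := ne_of_inner_pos (x := planeRefl a l p) hap (by rw [inner_planeRefl ha]; linarith)
  have hb := hu.pos _ hR.1 hR.2
  have hN : 1 < confDenom (planeRefl a l p) := by
    rw [← hNp]; exact confDenom_lt ha hl hpl
  have hN0 : 0 < confDenom (planeRefl a l p) := by linarith
  have hsmR := hu.smooth _ hR.1 hR.2
  have hRc : Continuous (planeRefl a l) := (contDiff_planeRefl a l).continuous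
  have heqR := hu.eqn _ hR.1 hR.2
  rw [inner_planeRefl_of_orthogonal hap, hpp] at heqR
  set b := u (planeRefl a l p)
  set N' := confDenom (planeRefl a l p)
  have ht1 : 1 / N' < 1 := by rw [div_lt_one hN0]; exact hN
  have ht0' : 0 < 1 / N' := by positivity
  obtain ⟨t₀, ht₀, ht₀1⟩ := exists_between ht1
  have ht₀m : t₀ ∈ Set.Ioo (-1 : ℝ) 1 := ⟨by linarith, ht₀1⟩
  have hkey : H (1 / N') (N' ^ k * b) < H t₀ b := by
    have hlt : b < N' ^ k * b := by
      have := Real.one_lt_rpow hN hu.k_pos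
      nlinarith
    have hmem : 1 / N' ∈ Set.Ioo (-1 : ℝ) 1 := ⟨by linarith, ht1⟩
    have hb' : 0 < N' ^ k * b := hb.trans hlt
    rcases hu.nonlin.strict with ⟨hs, -⟩ | hs
    · exact (hu.nonlin.anti _ hmem (Set.mem_Ioi.2 hb) (Set.mem_Ioi.2 hb') hlt.le).trans_lt
        (hs b hb _ _ ht₀1 ht₀ ht0')
    · exact (hs _ hmem (Set.mem_Ioi.2 hb) (Set.mem_Ioi.2 hb') hlt).trans_le
        (hu.nonlin.mono_pos b hb _ _ ht₀1 ht₀ ht0')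
  have hconfc : Continuous (confDenom : F → ℝ) := by unfold confDenom; fun_prop
  have hQc : ContinuousAt (fun y : F × ℝ => y.2 ^ P * H t₀ (confDenom y.1 ^ k * y.2) +
      Δ u (planeRefl a l y.1)) (p, b) := by
    refine ContinuousAt.add (ContinuousAt.mul ?_ ?_) ?_
    · exact continuousAt_snd.rpow_const (Or.inl hb.ne')
    · have h1 : ContinuousAt (H t₀) (confDenom p ^ k * b) :=
        (hu.nonlin.cont t₀ ht₀m).continuousAt (Ioi_mem_nhds (by rw [hNp]; simpa using hb))
      refine ContinuousAt.comp (f := fun y : F × ℝ => confDenom y.1 ^ k * y.2) (x := (p, b)) h1 ?_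
      have h2 : Continuous fun y : F × ℝ => confDenom y.1 := hconfc.comp continuous_fst
      exact (h2.continuousAt.rpow_const (Or.inl (confDenom_pos _).ne')).mul continuousAt_snd
    · have h1 : ContinuousAt (Δ u) (planeRefl a l p) := continuousAt_laplacian hsmR
      exact ContinuousAt.comp (f := fun y : F × ℝ => planeRefl a l y.1) (x := (p, b)) h1
        (hRc.comp continuous_fst).continuousAt
  have hQpos : 0 < b ^ P * H t₀ (confDenom p ^ k * b) + Δ u (planeRefl a l p) := by
    rw [hNp, Real.one_rpow, one_mul]
    have := mul_lt_mul_of_pos_left hkey (Real.rpow_pos_of_pos hb P)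
    linarith
  have hQev := hQc.eventually (lt_mem_nhds hQpos)
  rw [nhds_prod_eq, Filter.eventually_prod_iff] at hQev
  obtain ⟨pa, hpa', pb, hpb', hQ⟩ := hQev
  obtain ⟨ε, hε, hεb⟩ := Metric.eventually_nhds_iff.1 hpb'
  have hev : ∀ᶠ x in 𝓝 p, pa x ∧ |u (planeRefl a l x) - b| < ε / 2 ∧
      t₀ < ⟪x, p⟫_ℝ / confDenom x ∧ ⟪x, a⟫_ℝ < l ∧ 0 < ⟪x, p⟫_ℝ := by
    have v1 : ContinuousAt (fun x => u (planeRefl a l x)) p :=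
      ContinuousAt.comp (f := planeRefl a l) (x := p) hsmR.continuousAt hRc.continuousAt
    have v2 : ContinuousAt (fun x => |u (planeRefl a l x) - b|) p := (v1.sub continuousAt_const).abs
    have v3 : ContinuousAt (fun x => ⟪x, p⟫_ℝ / confDenom x) p :=
      ContinuousAt.div (by fun_prop) hconfc.continuousAt (confDenom_pos p).ne'
    refine hpa'.and ((v2.eventually (gt_mem_nhds ?_)).and ((v3.eventually (lt_mem_nhds ?_)).and
      (((Continuous.tendsto (by fun_prop) p).eventually (gt_mem_nhds hpl)).and
      ((Continuous.tendsto (by fun_prop) p).eventually (lt_mem_nhds ?_)))))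
    · simp only [b, sub_self, abs_zero]; positivity
    · simpa only [hpp, hNp, div_one] using ht₀1
    · rw [hpp]; norm_num
  obtain ⟨r₀, hr₀, hball⟩ := Metric.eventually_nhds_iff.1 hev
  set r := r₀ / 2 with hr
  have hr0 : 0 < r := half_pos hr₀
  have hin : ∀ x, ‖x - p‖ ≤ r → _ := fun x hx => @hball x (by rw [dist_eq_norm]; linarith)
  have hne : ∀ x, ‖x - p‖ ≤ r → x ≠ -p := by
    rintro x hx rfl
    have := (hin _ hx).2.2.2.2
    rw [inner_neg_left, hpp] at this
    linarith
  set z : F → ℝ := fun x => u x - u (planeRefl a l x) with hz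
  have hzsm : ∀ x, x ≠ p → ‖x - p‖ ≤ r → ContDiffAt ℝ 2 z x := fun x hx hxr => by
    obtain ⟨c1, c2⟩ := hu.contDiffAt_diff hap ha hl (hin x hxr).2.2.2.1.le hx (hne x hxr)
    exact c2.sub c1
  have hnesph : ∀ x, x ∈ Metric.sphere p r → x ≠ p := by
    rintro x hx rfl
    simp at hx; linarith
  obtain ⟨m₀, hm₀, hm₀'⟩ := (isCompact_sphere p r).exists_forall_le' (f := z) (a := 0)
    (fun x hx => (hzsm x (hnesph x hx)
      (by rw [← dist_eq_norm]; exact hx.le)).continuousAt.continuousWithinAt) (by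
    intro x hx
    have hxr : ‖x - p‖ ≤ r := by rw [← dist_eq_norm]; exact hx.le
    have := hu.refl_lt hap ha hl hle (hin x hxr).2.2.2.1 (hin x hxr).2.2.2.2.ne'
      (hnesph x hx) (hne x hxr)
    linarith)
  refine ⟨r, min m₀ (ε / 2), hr0, lt_min hm₀ (half_pos hε), ?_⟩
  refine le_of_superharmonic_punctured hu.dim (lt_min hm₀ (half_pos hε)) hzsm ?_ ?_ ?_
  · intro x hx hxr
    have := hle x (hin x hxr).2.2.2.1 hx (hne x hxr)
    linarith
  · intro x hx
    exact (min_le_left _ _).trans (hm₀' x (by rw [mem_sphere_iff_norm]; exact hx))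
  · intro x hx hxr hzx
    obtain ⟨w1, w2, w3, w4, w5⟩ := hin x hxr
    have hz0 := hle x w4 hx (hne x hxr)
    have hzε : u x - u (planeRefl a l x) < ε / 2 := hzx.trans_le (min_le_right _ _)
    have hux := hu.pos x hx (hne x hxr)
    have hQx := hQ w1 (hεb (y := u x) (by
      rw [Real.dist_eq, abs_lt]
      obtain ⟨w21, w22⟩ := abs_lt.1 w2
      constructor <;> linarith))
    obtain ⟨c1, c2⟩ := hu.contDiffAt_diff hap ha hl w4.le hx (hne x hxr)
    have hneR := ne_of_inner_pos (x := planeRefl a l x) hap (by rw [inner_planeRefl ha]; linarith)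
    rw [laplacian_fun_sub c2 c1, laplacian_comp_planeRefl ha l (hu.smooth _ hneR.1 hneR.2)]
    have e1 := hu.eqn x hx (hne x hxr)
    have hmono : H t₀ (confDenom x ^ k * u x) ≤
        H (⟪x, p⟫_ℝ / confDenom x) (confDenom x ^ k * u x) :=
      hu.nonlin.mono_pos _ (by have := confDenom_pos x; positivity) _ _
        (div_mem_Ioo (abs_inner_lt_confDenom hp hx (hne x hxr))).2 w3 (by linarith)
    have := mul_le_mul_of_nonneg_left hmono (Real.rpow_pos_of_pos hux P).le
    linarith

theorem exists_le_sub_near_poles (hu : ProjSolution p k P H u) (hap : ⟪a, p⟫_ℝ = 0) (ha : ‖a‖ = 1)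
    {l : ℝ} (hl : 0 < l)
    (hle : ∀ x, ⟪x, a⟫_ℝ < l → x ≠ p → x ≠ -p → u (planeRefl a l x) ≤ u x) :
    ∃ r m : ℝ, 0 < r ∧ 0 < m ∧ ∀ x, x ≠ p → x ≠ -p → (‖x - p‖ ≤ r ∨ ‖x + p‖ ≤ r) →
      m ≤ u x - u (planeRefl a l x) := by
  obtain ⟨r₁, m₁, hr₁, hm₁, h₁⟩ := hu.exists_le_sub_near_pole hap ha hl hle
  obtain ⟨r₂, m₂, hr₂, hm₂, h₂⟩ := hu.neg.exists_le_sub_near_pole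
    (by rw [inner_neg_right, hap, neg_zero]) ha hl
    (fun x hx n1 n2 => hle x hx (by simpa using n2) n1)
  refine ⟨min r₁ r₂, min m₁ m₂, lt_min hr₁ hr₂, lt_min hm₁ hm₂, fun x n1 n2 hx => ?_⟩
  rcases hx with hx | hx
  · exact (min_le_left _ _).trans (h₁ x n1 (hx.trans (min_le_left _ _)))
  · exact (min_le_right _ _).trans (h₂ x n2
      (by rw [sub_neg_eq_add]; exact hx.trans (min_le_right _ _)))

/-- It suffices to compare the solution with its reflection on a bounded region, away from the
reflecting hyperplane and from `⟪x, p⟫ = 0`. -/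
theorem refl_le_of_bounded_region (hu : ProjSolution p k P H u) (hap : ⟪a, p⟫_ℝ = 0)
    (ha : ‖a‖ = 1) {r : ℝ} (hr0 : 0 < r) (hr : r ≤ 1 / 2) :
    ∃ Q : ℝ, 1 ≤ Q ∧ ∀ m, 2 * r ≤ m → ∃ δ : ℝ, 0 < δ ∧ ∀ l, r ≤ l → l ≤ m →
      (∀ x, ⟪x, a⟫_ℝ < l → x ≠ p → x ≠ -p → 1 + ‖x‖ ^ 2 ≤ 16 * Q → δ ≤ |⟪x, p⟫_ℝ| →
        ⟪x, a⟫_ℝ ≤ m - δ → u (planeRefl a l x) ≤ u x) →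
      ∀ x, ⟪x, a⟫_ℝ < l → x ≠ p → x ≠ -p → u (planeRefl a l x) ≤ u x := by
  obtain ⟨C₁, hC, hlin⟩ := hu.linear_ineq hap ha hr0
  refine ⟨16 * C₁ + 1, by linarith, fun m hm => ?_⟩
  set Q := 16 * C₁ + 1 with hQ
  have hQ1 : 1 ≤ Q := by linarith
  set K := 2 + 32 * Q + |m| with hK
  have hK0 : 0 < K := by have := abs_nonneg m; linarith
  set κ := 1 / (4 * K) with hκ
  have hκ0 : 0 < κ := by positivity
  set δ := min r (κ / (4 * (C₁ + 1))) with hδ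
  have hδ0 : 0 < δ := lt_min hr0 (by positivity)
  have hδr : δ ≤ r := min_le_left _ _
  have hδκ : δ ≤ κ / (4 * (C₁ + 1)) := min_le_right _ _
  refine ⟨δ, hδ0, fun l hrl hlm hneg => ?_⟩
  refine hu.refl_le_of_narrow hap ha hr0 hr hrl hlm (by linarith) hδ0 (hδr.trans hr) hκ0 hQ1 hC
    (hlin l hrl) (by linarith) ?_ ?_ hneg
  · rw [le_div_iff₀ (by positivity)] at hδκ
    rw [mul_one_div, lt_div_iff₀ (by positivity)]
    nlinarith
  · intro x hx
    have hroot : ∀ s, √(δ ^ 2 + s ^ 2) ≤ 1 + |s| := fun s => by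
      rw [Real.sqrt_le_left (by positivity)]
      have := abs_nonneg s
      have := sq_abs s
      nlinarith
    have hxn : ‖x‖ ≤ 16 * Q := by nlinarith [norm_nonneg x]
    have i1 := abs_real_inner_le_norm x a
    have i2 := abs_real_inner_le_norm x p
    rw [ha, mul_one] at i1
    rw [hu.norm_pole, mul_one] at i2
    have j1 := hroot (⟪x, a⟫_ℝ - m)
    have j2 := hroot (⟪x, p⟫_ℝ - 0)
    have j3 := abs_sub (⟪x, a⟫_ℝ) m
    rw [sub_zero] at j2
    have : √(δ ^ 2 + (⟪x, a⟫_ℝ - m) ^ 2) + √(δ ^ 2 + (⟪x, p⟫_ℝ - 0) ^ 2) ≤ K := by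
      rw [sub_zero]; linarith
    refine (mul_le_mul_of_nonneg_left this hκ0.le).trans_lt ?_
    have : κ * K = 1 / 4 := by rw [hκ]; field_simp
    linarith

/-- Positive lower bound on bounded sets, up to the singular points. -/
theorem exists_pos_le (hu : ProjSolution p k P H u) (Q : ℝ) :
    ∃ c : ℝ, 0 < c ∧ ∀ x, x ≠ p → x ≠ -p → confDenom x ≤ Q → c ≤ u x := by
  obtain ⟨c₁, r, hc₁, hr, hpole⟩ := hu.pole
  obtain ⟨c₂, C, B, hc₂, -, hbd⟩ := hu.bdd r hr
  have hQ : 0 < |Q| + 1 := by positivity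
  refine ⟨min c₁ (c₂ / (|Q| + 1) ^ k), lt_min hc₁ (by positivity), fun x n1 n2 hx => ?_⟩
  by_cases h : ‖x - p‖ < r ∨ ‖x + p‖ < r
  · exact (min_le_left _ _).trans (hpole x n1 n2 h)
  · push Not at h
    obtain ⟨h1, -, -⟩ := hbd x h.1 h.2
    refine (min_le_right _ _).trans ?_
    rw [div_le_iff₀ (by positivity), mul_comm]
    refine h1.trans (mul_le_mul_of_nonneg_right ?_ (hu.pos x n1 n2).le)
    exact Real.rpow_le_rpow (confDenom_pos x).le (by linarith [le_abs_self Q]) hu.k_pos.le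

/-- The moving plane procedure can be started. -/
theorem exists_forall_ge_refl_le (hu : ProjSolution p k P H u) (hap : ⟪a, p⟫_ℝ = 0)
    (ha : ‖a‖ = 1) : ∃ Λ : ℝ, 0 < Λ ∧ ∀ l, Λ ≤ l → ∀ x, ⟪x, a⟫_ℝ < l → x ≠ p → x ≠ -p →
      u (planeRefl a l x) ≤ u x := by
  obtain ⟨Q, hQ, hreg⟩ := hu.refl_le_of_bounded_region hap ha (r := 1 / 2) (by norm_num) le_rfl
  obtain ⟨C, hC, hCb⟩ := hu.refl_le hap ha (r := 1 / 2) (by norm_num)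
  obtain ⟨c, hc, hlow⟩ := hu.exists_pos_le (8 * Q)
  have hlim : Tendsto (fun l : ℝ => C * l ^ (-k)) atTop (𝓝 0) := by
    simpa using (tendsto_rpow_neg_atTop hu.k_pos).const_mul C
  obtain ⟨Λ, hΛ⟩ := eventually_atTop.1 (hlim.eventually (gt_mem_nhds hc))
  refine ⟨max Λ 2, by positivity, fun l hl => ?_⟩
  have hl2 : 2 ≤ l := (le_max_right _ _).trans hl
  obtain ⟨δ, -, hδ⟩ := hreg l (by linarith)
  refine hδ l (by linarith) le_rfl fun x hx n1 n2 hxQ _ _ => ?_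
  refine (hCb l (by linarith) x hx.le).trans (le_trans ?_ (hlow x n1 n2 (by
    unfold confDenom; linarith)))
  refine le_trans ?_ (hΛ l ((le_max_left _ _).trans hl)).le
  refine mul_le_mul_of_nonneg_left ?_ hC.le
  refine Real.rpow_le_rpow_of_nonpos (by linarith) ?_ (by linarith [hu.k_pos])
  have i := real_inner_le_norm (planeRefl a l x) a
  rw [inner_planeRefl ha, ha, mul_one] at i
  unfold confDenom
  nlinarith

/-- The moving plane procedure can be continued past a positive position. -/
theorem exists_lt_forall_refl_le (hu : ProjSolution p k P H u) (hap : ⟪a, p⟫_ℝ = 0)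
    (ha : ‖a‖ = 1) {m : ℝ} (hm : 0 < m)
    (hle : ∀ x, ⟪x, a⟫_ℝ < m → x ≠ p → x ≠ -p → u (planeRefl a m x) ≤ u x) :
    ∃ ε : ℝ, 0 < ε ∧ ε < m ∧ ∀ l, m - ε ≤ l → l ≤ m → ∀ x, ⟪x, a⟫_ℝ < l → x ≠ p → x ≠ -p →
      u (planeRefl a l x) ≤ u x := by
  set r := min (1 / 2) (m / 4) with hr
  have hr0 : 0 < r := lt_min (by norm_num) (by linarith)
  have hrm : r ≤ m / 4 := min_le_right _ _
  obtain ⟨Q, hQ, hreg⟩ := hu.refl_le_of_bounded_region hap ha hr0 (min_le_left _ _)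
  obtain ⟨δ, hδ0, hδ⟩ := hreg m (by linarith)
  obtain ⟨r₁, m₁, hr₁, hm₁, hpole⟩ := hu.exists_le_sub_near_poles hap ha hm hle
  set L := 16 * Q with hL
  set K : Set F := {x | ‖x‖ ≤ L ∧ ⟪x, a⟫_ℝ ≤ m - δ} with hK
  have hKc : IsCompact K := by
    refine Metric.isCompact_of_isClosed_isBounded ?_ ?_
    · have z1 : IsClosed {x : F | ‖x‖ ≤ L} := isClosed_le (by fun_prop) continuous_const
      have z2 : IsClosed {x : F | ⟪x, a⟫_ℝ ≤ m - δ} := isClosed_le (by fun_prop) continuous_const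
      exact z1.inter z2
    · exact (Metric.isBounded_closedBall (x := (0 : F)) (r := L)).subset fun x hx => by
        simpa using hx.1
  set K' : Set F := K ∩ {x | δ ≤ |⟪x, p⟫_ℝ| ∧ r₁ ≤ ‖x - p‖ ∧ r₁ ≤ ‖x + p‖} with hK'
  have hK'c : IsCompact K' := by
    refine hKc.inter_right ?_
    have z1 : IsClosed {x : F | δ ≤ |⟪x, p⟫_ℝ|} :=
      isClosed_le continuous_const (Continuous.abs (by fun_prop))
    have z2 : IsClosed {x : F | r₁ ≤ ‖x - p‖} := isClosed_le continuous_const (by fun_prop)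
    have z3 : IsClosed {x : F | r₁ ≤ ‖x + p‖} := isClosed_le continuous_const (by fun_prop)
    exact z1.inter (z2.inter z3)
  obtain ⟨m₂, hm₂, hbulk⟩ := hK'c.exists_forall_le' (f := fun x => u x - u (planeRefl a m x))
    (a := 0) (by
      intro x hx
      obtain ⟨n1, n2⟩ := ne_of_le_norm hr₁ hx.2.2.1 hx.2.2.2
      obtain ⟨c1, c2⟩ := hu.contDiffAt_diff hap ha hm (by linarith [hx.1.2]) n1 n2
      exact (c2.sub c1).continuousAt.continuousWithinAt) (by
      intro x hx
      obtain ⟨n1, n2⟩ := ne_of_le_norm hr₁ hx.2.2.1 hx.2.2.2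
      have hne : ⟪x, p⟫_ℝ ≠ 0 := fun h => by
        have := hx.2.1
        rw [h, abs_zero] at this
        linarith
      have := hu.refl_lt hap ha hm hle (by linarith [hx.1.2]) hne n1 n2
      linarith)
  have hcont : ContinuousOn (fun y : ℝ × F => u (planeRefl a y.1 y.2))
      (Set.Icc (m / 2) m ×ˢ K) := by
    rintro ⟨l, x⟩ ⟨hl, hx⟩
    have hne := ne_of_inner_pos (x := planeRefl a l x) hap (by
      rw [inner_planeRefl ha]
      have := hl.1
      have := hx.2
      simp only at *
      linarith)
    exact (ContinuousAt.comp (f := fun y : ℝ × F => planeRefl a y.1 y.2) (x := (l, x))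
      (hu.smooth _ hne.1 hne.2).continuousAt (continuous_planeRefl a).continuousAt).continuousWithinAt
  have hunif := (isCompact_Icc.prod hKc).uniformContinuousOn_of_continuous hcont
  obtain ⟨ε, hε, hεu⟩ := Metric.uniformContinuousOn_iff.1 hunif (min m₁ m₂) (lt_min hm₁ hm₂)
  refine ⟨min (ε / 2) (m / 2), lt_min (half_pos hε) (half_pos hm),
    (min_le_right _ _).trans_lt (half_lt_self hm), fun l hl hlm => ?_⟩
  have hl1 : m - l ≤ ε / 2 := by linarith [min_le_left (ε / 2) (m / 2)]
  have hl2 : m / 2 ≤ l := by linarith [min_le_right (ε / 2) (m / 2)]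
  refine hδ l (by linarith) hlm fun x hx n1 n2 hxQ hxp hxa => ?_
  have hxK : x ∈ K := ⟨by nlinarith [norm_nonneg x], hxa⟩
  have hd := hεu (l, x) ⟨⟨hl2, hlm⟩, hxK⟩ (m, x) ⟨⟨by simp only; linarith, le_rfl⟩, hxK⟩ (by
    rw [Prod.dist_eq, dist_self, Real.dist_eq, abs_of_nonpos (by simp only; linarith)]
    exact max_lt (by simp only; linarith) hε)
  rw [Real.dist_eq, abs_lt] at hd
  have hz : min m₁ m₂ ≤ u x - u (planeRefl a m x) := by
    by_cases h : ‖x - p‖ ≤ r₁ ∨ ‖x + p‖ ≤ r₁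
    · exact (min_le_left _ _).trans (hpole x n1 n2 h)
    · push Not at h
      exact (min_le_right _ _).trans (hbulk x ⟨hxK, hxp, h.1.le, h.2.le⟩)
  simp only at hd
  linarith [hd.2]

theorem refl_le_of_forall_gt (hu : ProjSolution p k P H u) (hap : ⟪a, p⟫_ℝ = 0) (ha : ‖a‖ = 1)
    {m : ℝ} (hm : 0 ≤ m)
    (hle : ∀ l, m < l → ∀ x, ⟪x, a⟫_ℝ < l → x ≠ p → x ≠ -p → u (planeRefl a l x) ≤ u x) :
    ∀ x, ⟪x, a⟫_ℝ < m → x ≠ p → x ≠ -p → u (planeRefl a m x) ≤ u x := by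
  intro x hx n1 n2
  have hne := ne_of_inner_pos (x := planeRefl a m x) hap (by rw [inner_planeRefl ha]; linarith)
  have hc : Continuous fun l : ℝ => planeRefl a l x := by unfold planeRefl; fun_prop
  have hcont : ContinuousAt (fun l : ℝ => u (planeRefl a l x)) m :=
    ContinuousAt.comp (f := fun l : ℝ => planeRefl a l x) (x := m)
      (hu.smooth _ hne.1 hne.2).continuousAt hc.continuousAt
  refine le_of_tendsto (hcont.tendsto.mono_left (nhdsWithin_le_nhds (s := Set.Ioi m))) ?_
  filter_upwards [self_mem_nhdsWithin] with l hl
  exact hle l hl x (hx.trans hl) n1 n2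

theorem refl_zero_le (hu : ProjSolution p k P H u) (hap : ⟪a, p⟫_ℝ = 0) (ha : ‖a‖ = 1) :
    ∀ x, ⟪x, a⟫_ℝ < 0 → x ≠ p → x ≠ -p → u (planeRefl a 0 x) ≤ u x := by
  obtain ⟨Λ, hΛ, hstart⟩ := hu.exists_forall_ge_refl_le hap ha
  set S : Set ℝ := {l | 0 < l ∧ ∀ l', l ≤ l' → ∀ x, ⟪x, a⟫_ℝ < l' → x ≠ p → x ≠ -p →
    u (planeRefl a l' x) ≤ u x} with hS
  have hΛS : Λ ∈ S := ⟨hΛ, hstart⟩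
  have hbdd : BddBelow S := ⟨0, fun l hl => hl.1.le⟩
  have hm0 : 0 ≤ sInf S := le_csInf ⟨Λ, hΛS⟩ fun l hl => hl.1.le
  have hgt : ∀ l, sInf S < l → ∀ x, ⟪x, a⟫_ℝ < l → x ≠ p → x ≠ -p →
      u (planeRefl a l x) ≤ u x := fun l hl => by
    obtain ⟨s, hs, hsl⟩ := exists_lt_of_csInf_lt ⟨Λ, hΛS⟩ hl
    exact hs.2 l hsl.le
  have hinf := hu.refl_le_of_forall_gt hap ha hm0 hgt
  rcases hm0.eq_or_lt with h | h
  · rwa [← h] at hinf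
  · exfalso
    obtain ⟨ε, hε, hεm, hcontn⟩ := hu.exists_lt_forall_refl_le hap ha h hinf
    have : sInf S - ε ∈ S := ⟨by linarith, fun l hl => by
      rcases le_or_gt l (sInf S) with h1 | h1
      · exact hcontn l hl h1
      · exact hgt l h1⟩
    linarith [csInf_le hbdd this]

/-- Reflection symmetry with respect to every hyperplane through the origin and the poles. -/
theorem comp_planeRefl_zero (hu : ProjSolution p k P H u) (hap : ⟪a, p⟫_ℝ = 0) (ha : ‖a‖ = 1)
    {x : F} (h1 : x ≠ p) (h2 : x ≠ -p) : u (planeRefl a 0 x) = u x := by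
  have key : ∀ b : F, ⟪b, p⟫_ℝ = 0 → ‖b‖ = 1 → ∀ y, ⟪y, b⟫_ℝ < 0 → y ≠ p → y ≠ -p →
      u (planeRefl b 0 y) = u y := by
    intro b hbp hb y hy n1 n2
    have hin := inner_planeRefl hb 0 y
    have hne := ne_of_inner_pos (x := planeRefl b 0 y) hbp (by rw [hin]; linarith)
    refine le_antisymm (hu.refl_zero_le hbp hb y hy n1 n2) ?_
    have := hu.refl_zero_le (a := -b) (by rw [inner_neg_left, hbp, neg_zero])
      (by rwa [norm_neg]) (planeRefl b 0 y) (by rw [inner_neg_right, hin]; linarith) hne.1 hne.2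
    have e : planeRefl (-b) 0 (planeRefl b 0 y) = y := by
      rw [planeRefl, inner_neg_right, hin, planeRefl]
      module
    rwa [e] at this
  rcases lt_trichotomy ⟪x, a⟫_ℝ 0 with h | h | h
  · exact key a hap ha x h h1 h2
  · rw [planeRefl_of_inner_eq h]
  · have := key (-a) (by rw [inner_neg_left, hap, neg_zero]) (by rwa [norm_neg]) x
      (by rw [inner_neg_right]; linarith) h1 h2
    have e : planeRefl (-a) 0 x = planeRefl a 0 x := by
      rw [planeRefl, planeRefl, inner_neg_right]; module
    rwa [e] at this

end ProjSolution

end MovingPlanes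

section Stereographic

variable {E : Type*} [NormedAddCommGroup E] [InnerProductSpace ℝ E]

omit [InnerProductSpace ℝ E] in
theorem fderiv_of_homogeneous [NormedSpace ℝ E] {W : Type*} [NormedAddCommGroup W]
    [NormedSpace ℝ W] {f : E → W} {j : ℝ} (hf : ∀ c : ℝ, 0 < c → ∀ y, y ≠ 0 → f (c • y) = c ^ j • f y) :
    ∀ c : ℝ, 0 < c → ∀ y, y ≠ 0 → fderiv ℝ f (c • y) = c ^ (j - 1) • fderiv ℝ f y := by
  intro c hc y hy
  have h1 : fderiv ℝ (fun z => f (c • z)) y = c • fderiv ℝ f (c • y) := fderiv_comp_smul c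
  have h2 : (fun z => f (c • z)) =ᶠ[𝓝 y] c ^ j • f := by
    filter_upwards [isOpen_ne.mem_nhds hy] with z hz using hf c hc z hz
  rw [h2.fderiv_eq, fderiv_const_smul_field, Pi.smul_apply] at h1
  rw [Real.rpow_sub_one hc.ne', div_eq_inv_mul, mul_smul, h1, smul_smul, inv_mul_cancel₀ hc.ne',
    one_smul]

omit [InnerProductSpace ℝ E] in
/-- Euler's relation for homogeneous functions. -/
theorem fderiv_apply_self_of_homogeneous [NormedSpace ℝ E] {W : Type*} [NormedAddCommGroup W]
    [NormedSpace ℝ W] {f : E → W} {j : ℝ}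
    (hf : ∀ c : ℝ, 0 < c → ∀ y, y ≠ 0 → f (c • y) = c ^ j • f y) {x : E} (hx : x ≠ 0)
    (hd : DifferentiableAt ℝ f x) : fderiv ℝ f x x = j • f x := by
  have h1 : HasDerivAt (fun c : ℝ => f (c • x)) (fderiv ℝ f x x) 1 := by
    have h : HasDerivAt (fun c : ℝ => c • x) x 1 := by simpa using (hasDerivAt_id (1 : ℝ)).smul_const x
    have hd' : HasFDerivAt f (fderiv ℝ f x) ((fun c : ℝ => c • x) 1) := by
      simpa using hd.hasFDerivAt
    exact hd'.comp_hasDerivAt 1 h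
  have h2 : HasDerivAt (fun c : ℝ => c ^ j • f x) (j • f x) 1 := by
    simpa using (Real.hasDerivAt_rpow_const (x := 1) (p := j) (Or.inl one_ne_zero)).smul_const (f x)
  refine h1.unique (h2.congr_of_eventuallyEq ?_)
  filter_upwards [Ioi_mem_nhds (zero_lt_one (α := ℝ))] with c hc using hf c hc x hx

variable [FiniteDimensional ℝ E]

theorem laplacian_of_homogeneous {f : E → ℝ} {j : ℝ}
    (hf : ∀ c : ℝ, 0 < c → ∀ y, y ≠ 0 → f (c • y) = c ^ j • f y) {c : ℝ} (hc : 0 < c) {x : E}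
    (hx : x ≠ 0) : Δ f (c • x) = c ^ (j - 2) * Δ f x := by
  set b := stdOrthonormalBasis ℝ E
  rw [laplacian_eq_sum_fderiv_fderiv b, laplacian_eq_sum_fderiv_fderiv b, Finset.mul_sum]
  refine Finset.sum_congr rfl fun i _ => ?_
  rw [fderiv_of_homogeneous (fderiv_of_homogeneous hf) c hc x hx]
  simp only [smul_apply, smul_eq_mul]
  congr 2; ring

/-- Product rule for the Laplacian of a power of the norm times a function that is homogeneous of
degree zero, on the unit sphere. -/
theorem laplacian_rpow_mul_of_homogeneous {V : E → ℝ}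
    (hV : ∀ c : ℝ, 0 < c → ∀ y, y ≠ 0 → V (c • y) = V y) (a : ℝ) {x : E} (hx : ‖x‖ = 1)
    (hVx : ContDiffAt ℝ 2 V x) :
    (Δ (fun y => (0 + ‖y‖ ^ 2) ^ a * V y : E → ℝ)) x =
      (2 * a * Module.finrank ℝ E + 4 * a * (a - 1)) * V x + (Δ V) x := by
  have hx0 : x ≠ 0 := by rintro rfl; simp at hx
  have hq : 0 < 0 + ‖x‖ ^ 2 := by rw [hx]; norm_num
  set ρ : E → ℝ := fun y => (0 + ‖y‖ ^ 2) ^ a with hρ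
  have hρx : ContDiffAt ℝ 2 ρ x := contDiffAt_rpow_normSq hq
  have hρ1 : ρ x = 1 := by simp [hρ, hx]
  have hgrad : ∀ w, fderiv ℝ ρ x w = 2 * a * ⟪x, w⟫_ℝ := by
    intro w
    have h1 : HasFDerivAt (fun y : E => 0 + ‖y‖ ^ 2) (2 • innerSL ℝ x) x :=
      (hasStrictFDerivAt_norm_sq x).hasFDerivAt.const_add 0
    have h2 := (h1.rpow_const (p := a) (Or.inl hq.ne')).fderiv
    have e : (0 + ‖x‖ ^ 2 : ℝ) = 1 := by rw [hx]; norm_num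
    rw [hρ, h2, e]
    simp
    ring
  have hEuler : fderiv ℝ V x x = 0 := by
    have := fderiv_apply_self_of_homogeneous (f := V) (j := 0) (by simpa using hV) hx0
      (hVx.differentiableAt (by simp))
    simpa using this
  have hprod : ∀ w, fderiv ℝ (fderiv ℝ (fun y => ρ y * V y)) x w w =
      fderiv ℝ (fderiv ℝ ρ) x w w * V x + 2 * (fderiv ℝ ρ x w * fderiv ℝ V x w) +
        ρ x * fderiv ℝ (fderiv ℝ V) x w w := by
    intro w
    obtain ⟨r1, r2⟩ := second_deriv_along_curve (f := ρ) (c := fun t : ℝ => x + t • w)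
      (c' := fun _ => w) (c'' := 0) (s := 0) (by simpa using hρx) (hasDerivAt_line x w)
      (hasDerivAt_const _ _)
    obtain ⟨v1, v2⟩ := second_deriv_along_curve (f := V) (c := fun t : ℝ => x + t • w)
      (c' := fun _ => w) (c'' := 0) (s := 0) (by simpa using hVx) (hasDerivAt_line x w)
      (hasDerivAt_const _ _)
    have h := fderiv_fderiv_eq_of_line (x := x) (v := w) (hρx.mul hVx)
      (by filter_upwards [r1, v1] with t h1 h2 using h1.mul h2)
      ((r2.mul v1.self_of_nhds).add (r1.self_of_nhds.mul v2))
    rw [h]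
    simp only [zero_smul, add_zero, map_zero]
    ring
  set b := stdOrthonormalBasis ℝ E
  have hcross : ∑ i, fderiv ℝ ρ x (b i) * fderiv ℝ V x (b i) = 0 := by
    have hs : x = ∑ i, ⟪x, b i⟫_ℝ • b i := by
      conv_lhs => rw [← b.sum_repr' x]
      simp_rw [real_inner_comm]
    have : fderiv ℝ V x x = ∑ i, ⟪x, b i⟫_ℝ * fderiv ℝ V x (b i) := by
      have h := congrArg (fderiv ℝ V x) hs
      rw [map_sum] at h
      simpa only [map_smul, smul_eq_mul] using h
    rw [hEuler] at this
    simp_rw [hgrad, mul_assoc]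
    rw [← Finset.mul_sum, ← Finset.mul_sum, ← this]
    simp
  have hΔρ := laplacian_rpow_normSq (a := a) hq
  rw [laplacian_eq_sum_fderiv_fderiv b, laplacian_eq_sum_fderiv_fderiv b]
  change Δ ρ x = _ at hΔρ
  rw [laplacian_eq_sum_fderiv_fderiv b] at hΔρ
  rw [Finset.sum_congr rfl fun i _ => hprod (b i)]
  simp_rw [Finset.sum_add_distrib, ← Finset.mul_sum, hcross, ← Finset.sum_mul, hΔρ, hρ1, hx]
  simp

variable {F : Type*} [NormedAddCommGroup F] [InnerProductSpace ℝ F] [FiniteDimensional ℝ F]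

omit [FiniteDimensional ℝ E] [FiniteDimensional ℝ F] in
/-- A point on the line joining `ι x` to the point `e` of the unit sphere, whose direction is the
image of `x` under inverse stereographic projection. -/
noncomputable def stereoRay (ι : F →ₗᵢ[ℝ] E) (e : E) (x : F) : E :=
  ι x + ((‖x‖ ^ 2 - 1) / 2) • e

omit [FiniteDimensional ℝ E] [FiniteDimensional ℝ F] in
theorem contDiff_stereoRay (ι : F →ₗᵢ[ℝ] E) (e : E) : ContDiff ℝ 2 (stereoRay ι e) := by
  unfold stereoRay
  exact ι.toContinuousLinearMap.contDiff.add
    ((((contDiff_norm_sq ℝ).sub contDiff_const).div_const 2).smul contDiff_const)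

omit [FiniteDimensional ℝ E] [FiniteDimensional ℝ F] in
theorem norm_stereoRay {ι : F →ₗᵢ[ℝ] E} {e : E} (he : ‖e‖ = 1) (horth : ∀ x, ⟪ι x, e⟫_ℝ = 0)
    (x : F) : ‖stereoRay ι e x‖ = confDenom x := by
  have h : ‖stereoRay ι e x‖ ^ 2 = confDenom x ^ 2 := by
    rw [stereoRay, norm_add_sq_real, norm_smul, inner_smul_right, horth, he, ι.norm_map, confDenom,
      mul_one, Real.norm_eq_abs, sq_abs]
    ring
  exact (pow_left_inj₀ (norm_nonneg _) (confDenom_pos x).le two_ne_zero).1 h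

/-- Conformal covariance of the Laplacian under inverse stereographic projection, for functions
homogeneous of the critical degree. -/
theorem laplacian_comp_stereoRay {ι : F →ₗᵢ[ℝ] E} {e : E} (he : ‖e‖ = 1)
    (horth : ∀ x, ⟪ι x, e⟫_ℝ = 0) (hdim : Module.finrank ℝ E = Module.finrank ℝ F + 1)
    {f : E → ℝ} {k : ℝ} (hk : 2 * (k + 1) = Module.finrank ℝ F)
    (hf : ∀ c : ℝ, 0 < c → ∀ y, y ≠ 0 → f (c • y) = c ^ (-k) • f y) {x : F}
    (hfx : ContDiffAt ℝ 2 f (stereoRay ι e x)) :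
    Δ (fun y => f (stereoRay ι e y)) x = Δ f (stereoRay ι e x) := by
  set b := stdOrthonormalBasis ℝ F
  have hX0 : stereoRay ι e x ≠ 0 := by
    rw [← norm_pos_iff, norm_stereoRay he horth]; exact confDenom_pos x
  set w : Option (Fin (Module.finrank ℝ F)) → E := fun o => o.elim e fun i => ι (b i) with hw
  have hwo : Orthonormal ℝ w := by
    rw [orthonormal_iff_ite]
    have hbo := orthonormal_iff_ite.1 b.orthonormal
    rintro (_ | i) (_ | j)
    · simp [hw, he]
    · simpa [hw, real_inner_comm] using horth (b j)
    · simp [hw, horth]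
    · simp [hw, ι.inner_map_map, hbo]
  have hcard : Fintype.card (Option (Fin (Module.finrank ℝ F))) = Module.finrank ℝ E := by
    simp [hdim]
  set B := (basisOfOrthonormalOfCardEqFinrank hwo hcard).toOrthonormalBasis (by
    rwa [coe_basisOfOrthonormalOfCardEqFinrank]) with hB
  have hBw : ∀ o, B o = w o := fun o => by simp [hB]
  set X := stereoRay ι e x with hX
  set D2 := fderiv ℝ (fderiv ℝ f) X with hD2
  have hsymm : ∀ v v', D2 v v' = D2 v' v := fun v v' =>
    (hfx.isSymmSndFDerivAt (by simp)) v v'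
  have hEuler : D2 X e = (-k - 1) * fderiv ℝ f X e := by
    have := fderiv_apply_self_of_homogeneous (fderiv_of_homogeneous hf) hX0
      hfx.hasFDerivAt_fderiv.differentiableAt
    rw [hD2, this]; simp
  have hterm : ∀ i, fderiv ℝ (fderiv ℝ (fun y => f (stereoRay ι e y))) x (b i) (b i) =
      D2 (ι (b i)) (ι (b i)) + 2 * (⟪x, b i⟫_ℝ * D2 (ι (b i)) e) + ⟪x, b i⟫_ℝ ^ 2 * D2 e e +
        fderiv ℝ f X e := by
    intro i
    have hbi : ‖b i‖ = 1 := b.norm_eq_one i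
    have hc : ∀ t : ℝ, HasDerivAt (fun t : ℝ => stereoRay ι e (x + t • b i))
        (ι (b i) + (⟪x, b i⟫_ℝ + t) • e) t := by
      intro t
      have h1 : HasDerivAt (fun t : ℝ => ι (x + t • b i)) (ι (b i)) t :=
        ι.toContinuousLinearMap.hasFDerivAt.comp_hasDerivAt t (hasDerivAt_line x (b i) t)
      have h2 : HasDerivAt (fun t : ℝ => (‖x + t • b i‖ ^ 2 - 1) / 2) (⟪x, b i⟫_ℝ + t) t := by
        have e1 : (fun t : ℝ => (‖x + t • b i‖ ^ 2 - 1) / 2) =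
            fun t : ℝ => (‖x‖ ^ 2 + 2 * (t * ⟪x, b i⟫_ℝ) + t ^ 2 - 1) / 2 := by
          funext t
          rw [norm_add_sq_real, inner_smul_right, norm_smul, hbi, mul_one, Real.norm_eq_abs, sq_abs]
        rw [e1]
        have h3 := (((((hasDerivAt_id t).mul_const ⟪x, b i⟫_ℝ).const_mul 2).const_add
          (‖x‖ ^ 2)).add (hasDerivAt_pow 2 t)).sub_const 1 |>.div_const 2
        refine h3.congr_deriv ?_
        simp; ring
      exact h1.add (h2.smul_const e)
    have hc' : HasDerivAt (fun t : ℝ => ι (b i) + (⟪x, b i⟫_ℝ + t) • e) e 0 := by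
      simpa using (((hasDerivAt_id (0 : ℝ)).const_add ⟪x, b i⟫_ℝ).smul_const e).const_add (ι (b i))
    obtain ⟨d1, d2⟩ := second_deriv_along_curve (f := f)
      (c := fun t : ℝ => stereoRay ι e (x + t • b i)) (s := 0) (by simpa using hfx) hc hc'
    have hcomp : ContDiffAt ℝ 2 (fun y => f (stereoRay ι e y)) x :=
      hfx.comp x (contDiff_stereoRay ι e).contDiffAt
    rw [fderiv_fderiv_eq_of_line hcomp d1 d2]
    simp only [zero_smul, add_zero, ← hX, ← hD2, map_add, map_smul, smul_eq_mul,
      add_apply, smul_apply]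
    rw [hsymm e (ι (b i))]
    ring
  have hsumx : ∑ i, ⟪x, b i⟫_ℝ • b i = x := by
    conv_rhs => rw [← b.sum_repr' x]
    simp_rw [real_inner_comm]
  have hsq : ∑ i, ⟪x, b i⟫_ℝ ^ 2 = ‖x‖ ^ 2 := by
    have := b.sum_sq_norm_inner_left x
    simpa [sq_abs] using this
  have hlin : ∑ i, ⟪x, b i⟫_ℝ * D2 (ι (b i)) e = D2 (ι x) e := by
    have h := congrArg (fun z => D2 (ι z) e) hsumx
    simpa using h
  have hXe : D2 X e = D2 (ι x) e + (‖x‖ ^ 2 - 1) / 2 * D2 e e := by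
    conv_lhs => rw [hX]
    simp [stereoRay]
  rw [laplacian_eq_sum_fderiv_fderiv b, laplacian_eq_sum_fderiv_fderiv B]
  simp_rw [hterm, hBw, Fintype.sum_option, hw, Option.elim]
  rw [Finset.sum_add_distrib, Finset.sum_add_distrib, Finset.sum_add_distrib, ← Finset.mul_sum,
    hlin, ← Finset.sum_mul, hsq]
  simp only [Finset.sum_const, Finset.card_univ, Fintype.card_fin, nsmul_eq_mul]
  rw [← hk]
  linarith

end Stereographic

section SphereSolution

variable {E : Type*} [NormedAddCommGroup E] [InnerProductSpace ℝ E]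
variable {F : Type*} [NormedAddCommGroup F] [InnerProductSpace ℝ F]

/-- Inverse stereographic projection with centre `e`. -/
noncomputable def stereoInv (ι : F →ₗᵢ[ℝ] E) (e : E) (x : F) : E :=
  (confDenom x)⁻¹ • stereoRay ι e x

omit [InnerProductSpace ℝ F] in
theorem continuous_confDenom : Continuous (confDenom : F → ℝ) := by
  unfold confDenom; fun_prop

theorem continuous_stereoInv (ι : F →ₗᵢ[ℝ] E) (e : E) : Continuous (stereoInv ι e) :=
  (continuous_confDenom.inv₀ fun x => (confDenom_pos x).ne').smul (contDiff_stereoRay ι e).continuous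

theorem stereoInv_of_norm_eq_one (ι : F →ₗᵢ[ℝ] E) (e : E) {x : F} (hx : ‖x‖ = 1) :
    stereoInv ι e x = ι x := by
  simp [stereoInv, stereoRay, confDenom, hx]

/-- The sphere without the poles `±q`. -/
def puncturedSphere (q : E) : Set E := {θ | ‖θ‖ = 1 ∧ θ ≠ q ∧ θ ≠ -q}

variable {ι : F →ₗᵢ[ℝ] E} {e : E}

theorem norm_stereoInv (he : ‖e‖ = 1) (horth : ∀ x, ⟪ι x, e⟫_ℝ = 0) (x : F) :
    ‖stereoInv ι e x‖ = 1 := by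
  have h := confDenom_pos x
  rw [stereoInv, norm_smul, norm_stereoRay he horth, norm_inv, Real.norm_of_nonneg h.le,
    inv_mul_cancel₀ h.ne']

theorem inner_stereoInv (horth : ∀ x, ⟪ι x, e⟫_ℝ = 0) (x p : F) :
    ⟪stereoInv ι e x, ι p⟫_ℝ = ⟪x, p⟫_ℝ / confDenom x := by
  have h : ⟪e, ι p⟫_ℝ = 0 := by rw [real_inner_comm]; exact horth p
  rw [stereoInv, stereoRay, real_inner_smul_left, inner_add_left, real_inner_smul_left, h,
    ι.inner_map_map]
  ring

theorem stereoInv_mem_puncturedSphere (he : ‖e‖ = 1) (horth : ∀ x, ⟪ι x, e⟫_ℝ = 0) {x p : F}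
    (hp : ‖p‖ = 1) (h1 : x ≠ p) (h2 : x ≠ -p) : stereoInv ι e x ∈ puncturedSphere (ι p) := by
  have hN := confDenom_pos x
  have hlt := abs_inner_lt_confDenom hp h1 h2
  have hin := inner_stereoInv horth x p
  have hpp : ⟪ι p, ι p⟫_ℝ = 1 := by rw [real_inner_self_eq_norm_sq, ι.norm_map, hp]; norm_num
  have hI := div_mem_Ioo hlt
  refine ⟨norm_stereoInv he horth x, fun h => ?_, fun h => ?_⟩
  · rw [h, hpp] at hin
    linarith [hI.2]
  · rw [h, inner_neg_left, hpp] at hin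
    linarith [hI.1]

theorem stereoInv_inv_smul (he : ‖e‖ = 1) {θ : E} (hθ : ‖θ‖ = 1)
    (hq : ⟪θ, e⟫_ℝ < 1) {y : F} (hy : ι y = θ - ⟪θ, e⟫_ℝ • e) :
    confDenom ((1 - ⟪θ, e⟫_ℝ)⁻¹ • y) = (1 - ⟪θ, e⟫_ℝ)⁻¹ ∧
      stereoInv ι e ((1 - ⟪θ, e⟫_ℝ)⁻¹ • y) = θ := by
  set q := ⟪θ, e⟫_ℝ with hqd
  have h1q : 1 - q ≠ 0 := by linarith
  have hyn : ‖y‖ ^ 2 = 1 - q ^ 2 := by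
    rw [← ι.norm_map, hy, norm_sub_sq_real, inner_smul_right, norm_smul, he, hθ, ← hqd,
      Real.norm_eq_abs, mul_one, sq_abs]
    ring
  have hxn : ‖(1 - q)⁻¹ • y‖ ^ 2 = (1 + q) / (1 - q) := by
    rw [norm_smul, mul_pow, hyn, Real.norm_eq_abs, sq_abs]
    field_simp
    ring
  have hN : confDenom ((1 - q)⁻¹ • y) = (1 - q)⁻¹ := by
    rw [confDenom, hxn]; field_simp; ring
  refine ⟨hN, ?_⟩
  have hc : ((1 + q) / (1 - q) - 1) / 2 = (1 - q)⁻¹ * q := by field_simp; ring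
  rw [stereoInv, hN, stereoRay, hxn, map_smul, hy, inv_inv, hc, mul_smul, ← smul_add,
    sub_add_cancel, smul_smul, mul_inv_cancel₀ h1q, one_smul]

theorem exists_inner_bound {p : F} (hp : ‖p‖ = 1) {r : ℝ} (hr : 0 < r) :
    ∃ δ : ℝ, 0 < δ ∧ ∀ x : F, r ≤ ‖x - p‖ → ⟪x, p⟫_ℝ / confDenom x ≤ 1 - δ := by
  refine ⟨r ^ 2 / (3 + 2 * r ^ 2), by positivity, fun x hx => ?_⟩
  have hN := confDenom_pos x
  have h1 : ‖x - p‖ ^ 2 = ‖x‖ ^ 2 - 2 * ⟪x, p⟫_ℝ + 1 := by rw [norm_sub_sq_real, hp]; norm_num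
  have h2 : ‖x‖ ^ 2 ≤ 2 * ‖x - p‖ ^ 2 + 2 := by
    have h3 : ‖x‖ ≤ ‖x - p‖ + 1 := by
      simpa [hp] using norm_add_le (x - p) p
    nlinarith [norm_nonneg x, norm_nonneg (x - p), sq_nonneg (‖x - p‖ - 1)]
  have h3 : r ^ 2 ≤ ‖x - p‖ ^ 2 := by gcongr
  have e1 : 1 - r ^ 2 / (3 + 2 * r ^ 2) = (3 + r ^ 2) / (3 + 2 * r ^ 2) := by
    field_simp; ring
  rw [e1, div_le_div_iff₀ hN (by positivity), confDenom]
  nlinarith [mul_le_mul_of_nonneg_left h2 (sq_nonneg r)]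

theorem tendsto_stereoInv_pole (he : ‖e‖ = 1) (horth : ∀ x, ⟪ι x, e⟫_ℝ = 0) {p q : F}
    (hp : ‖p‖ = 1) (hq : ‖q‖ = 1) :
    Tendsto (stereoInv ι e) (𝓝[{x | x ≠ p ∧ x ≠ -p}] q) (𝓝[puncturedSphere (ι p)] (ι q)) := by
  refine tendsto_nhdsWithin_iff.2 ⟨?_, ?_⟩
  · rw [← stereoInv_of_norm_eq_one ι e hq]
    exact ((continuous_stereoInv ι e).tendsto q).mono_left nhdsWithin_le_nhds
  · filter_upwards [self_mem_nhdsWithin] with x hx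
    exact stereoInv_mem_puncturedSphere he horth hp hx.1 hx.2

theorem exists_pole_bound (he : ‖e‖ = 1) (horth : ∀ x, ⟪ι x, e⟫_ℝ = 0) {p q : F}
    (hp : ‖p‖ = 1) (hq : ‖q‖ = 1) {v : E → ℝ} (k : ℝ)
    (h : ∃ c : ℝ, 0 < c ∧ ∀ᶠ θ in 𝓝[puncturedSphere (ι p)] (ι q), c ≤ v θ) :
    ∃ c r : ℝ, 0 < c ∧ 0 < r ∧ ∀ x, x ≠ p → x ≠ -p → ‖x - q‖ < r →
      c ≤ confDenom x ^ (-k) * v (stereoInv ι e x) := by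
  obtain ⟨c, hc, hev⟩ := h
  have h1 := (tendsto_stereoInv_pole he horth hp hq).eventually hev
  have h2 : ∀ᶠ x in 𝓝 q, (1 / 2 : ℝ) < confDenom x ^ (-k) := by
    have hcont : ContinuousAt (fun x : F => confDenom x ^ (-k)) q :=
      continuous_confDenom.continuousAt.rpow_const (Or.inl (confDenom_pos q).ne')
    refine hcont.eventually_const_lt ?_
    simp [confDenom, hq]; norm_num
  have h3 := (eventually_nhdsWithin_iff.1 h1).and h2
  obtain ⟨r, hr, hr'⟩ := Metric.eventually_nhds_iff.1 h3
  refine ⟨1 / 2 * c, r, by positivity, hr, fun x hx1 hx2 hx => ?_⟩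
  obtain ⟨h4, h5⟩ := hr' (by rwa [dist_eq_norm])
  have := h4 ⟨hx1, hx2⟩
  gcongr

/-- The conformal factor times a function on the sphere, as a function in the target of the
stereographic projection. -/
noncomputable def stereoPull (ι : F →ₗᵢ[ℝ] E) (e : E) (k : ℝ) (v : E → ℝ) (x : F) : ℝ :=
  (0 + ‖stereoRay ι e x‖ ^ 2) ^ (-(k / 2)) * v (‖stereoRay ι e x‖⁻¹ • stereoRay ι e x)

theorem stereoPull_eq (he : ‖e‖ = 1) (horth : ∀ x, ⟪ι x, e⟫_ℝ = 0) (k : ℝ) (v : E → ℝ) (x : F) :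
    stereoPull ι e k v x = confDenom x ^ (-k) * v (stereoInv ι e x) := by
  rw [stereoPull, norm_stereoRay he horth, stereoInv, zero_add, ← Real.rpow_natCast,
    ← Real.rpow_mul (confDenom_pos x).le]
  congr 2
  push_cast; ring

theorem homogeneous_radial {v : E → ℝ} :
    ∀ c : ℝ, 0 < c → ∀ y : E, y ≠ 0 → v (‖c • y‖⁻¹ • c • y) = v (‖y‖⁻¹ • y) := by
  intro c hc y _
  rw [norm_smul, Real.norm_of_nonneg hc.le, smul_smul, mul_inv, mul_right_comm,
    inv_mul_cancel₀ hc.ne', one_mul]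

theorem homogeneous_rpow_mul_radial {v : E → ℝ} {k : ℝ} :
    ∀ c : ℝ, 0 < c → ∀ y : E, y ≠ 0 →
      (0 + ‖c • y‖ ^ 2) ^ (-(k / 2)) * v (‖c • y‖⁻¹ • c • y) =
        c ^ (-k) • ((0 + ‖y‖ ^ 2) ^ (-(k / 2)) * v (‖y‖⁻¹ • y)) := by
  intro c hc y hy
  rw [homogeneous_radial (v := v) c hc y hy, norm_smul, Real.norm_of_nonneg hc.le, zero_add, zero_add,
    mul_pow, Real.mul_rpow (by positivity) (by positivity), ← Real.rpow_natCast c,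
    ← Real.rpow_mul hc.le, smul_eq_mul, ← mul_assoc]
  congr 3
  push_cast; ring

theorem contDiffAt_radial_smul {v : E → ℝ} {θ : E} (hθ : ‖θ‖ = 1)
    (h : ContDiffAt ℝ 2 (fun y => v (‖y‖⁻¹ • y)) θ) {c : ℝ} (hc : 0 < c) :
    ContDiffAt ℝ 2 (fun y => v (‖y‖⁻¹ • y)) (c • θ) := by
  have h1 : ContDiffAt ℝ 2 (fun y : E => v (‖c⁻¹ • y‖⁻¹ • c⁻¹ • y)) (c • θ) := by
    have h2 : ContDiffAt ℝ 2 (fun y => v (‖y‖⁻¹ • y)) (c⁻¹ • c • θ) := by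
      rwa [smul_smul, inv_mul_cancel₀ hc.ne', one_smul]
    exact h2.comp (c • θ) (contDiff_const_smul c⁻¹).contDiffAt
  have h0 : c • θ ≠ 0 := by
    rw [← norm_pos_iff, norm_smul, hθ, Real.norm_of_nonneg hc.le]; linarith
  refine h1.congr_of_eventuallyEq ?_
  filter_upwards [isOpen_ne.mem_nhds h0] with y hy
  exact (homogeneous_radial c⁻¹ (inv_pos.2 hc) y hy).symm

theorem contDiffAt_rpow_mul_radial (he : ‖e‖ = 1) (horth : ∀ x, ⟪ι x, e⟫_ℝ = 0) (k : ℝ)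
    {v : E → ℝ} {x : F} (h : ContDiffAt ℝ 2 (fun y => v (‖y‖⁻¹ • y)) (stereoInv ι e x)) :
    ContDiffAt ℝ 2 (fun y : E => (0 + ‖y‖ ^ 2) ^ (-(k / 2)) * v (‖y‖⁻¹ • y))
      (stereoRay ι e x) := by
  have hN := confDenom_pos x
  have h1 := contDiffAt_radial_smul (norm_stereoInv he horth x) h hN
  rw [stereoInv, smul_smul, mul_inv_cancel₀ hN.ne', one_smul] at h1
  refine ContDiffAt.mul (contDiffAt_rpow_normSq ?_) h1
  rw [norm_stereoRay he horth]; positivity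

variable [FiniteDimensional ℝ E] [FiniteDimensional ℝ F]

/-- The conformal covariance of the conformal Laplacian under stereographic projection. -/
theorem laplacian_stereoPull (he : ‖e‖ = 1) (horth : ∀ x, ⟪ι x, e⟫_ℝ = 0)
    (hdim : Module.finrank ℝ E = Module.finrank ℝ F + 1) {n k : ℝ} (hn : Module.finrank ℝ F = n)
    (hk : k = (n - 2) / 2) {v : E → ℝ} {x : F}
    (h : ContDiffAt ℝ 2 (fun y => v (‖y‖⁻¹ • y)) (stereoInv ι e x)) :
    Δ (stereoPull ι e k v) x = confDenom x ^ (-k - 2) *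
      (-(n * (n - 2) / 4) * v (stereoInv ι e x) +
        (Δ (fun y : E => v (‖y‖⁻¹ • y))) (stereoInv ι e x)) := by
  have hN := confDenom_pos x
  have hΦ := norm_stereoInv he horth x
  have hΦ0 : stereoInv ι e x ≠ 0 := by rintro h; simp [h] at hΦ
  have h1 := laplacian_comp_stereoRay he horth hdim (k := k) (by rw [hn, hk]; ring)
    homogeneous_rpow_mul_radial (contDiffAt_rpow_mul_radial he horth k h)
  have hΨ : stereoRay ι e x = confDenom x • stereoInv ι e x := by
    rw [stereoInv, smul_smul, mul_inv_cancel₀ hN.ne', one_smul]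
  rw [hΨ, laplacian_of_homogeneous (homogeneous_rpow_mul_radial (v := v) (k := k)) hN hΦ0,
    laplacian_rpow_mul_of_homogeneous homogeneous_radial _ hΦ h, hdim] at h1
  refine h1.trans ?_
  push_cast
  rw [hn, hk, hΦ, inv_one, one_smul]
  ring

theorem projSolution_of_sphere (he : ‖e‖ = 1) (horth : ∀ x, ⟪ι x, e⟫_ℝ = 0)
    (hdim : Module.finrank ℝ E = Module.finrank ℝ F + 1) (hF : 3 ≤ Module.finrank ℝ F) {n k P : ℝ}
    (hn : Module.finrank ℝ F = n) (hk : k = (n - 2) / 2) (hP : P = (n + 2) / (n - 2))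
    {p : F} (hp : ‖p‖ = 1) {v : E → ℝ} {G : ℝ → ℝ → ℝ}
    (hsmooth : ∀ θ ∈ puncturedSphere (ι p), ContDiffAt ℝ 2 (fun y => v (‖y‖⁻¹ • y)) θ)
    (hpos : ∀ θ ∈ puncturedSphere (ι p), 0 < v θ)
    (heq : ∀ θ ∈ puncturedSphere (ι p),
      -((Δ (fun y : E => v (‖y‖⁻¹ • y))) θ - n * (n - 2) / 4 * v θ) = G ⟪θ, ι p⟫_ℝ (v θ))
    (hcont : ContinuousOn (fun q : E × ℝ => G ⟪q.1, ι p⟫_ℝ q.2)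
      (puncturedSphere (ι p) ×ˢ Set.Ioi 0))
    (hnorth : ∃ c : ℝ, 0 < c ∧ ∀ᶠ θ in 𝓝[puncturedSphere (ι p)] (ι p), c ≤ v θ)
    (hsouth : ∃ c : ℝ, 0 < c ∧ ∀ᶠ θ in 𝓝[puncturedSphere (ι p)] (-ι p), c ≤ v θ)
    (hG : NonlinAdm fun t s => s ^ (-P) * G t s) :
    ProjSolution p k P (fun t s => s ^ (-P) * G t s) (stereoPull ι e k v) := by
  have hn3 : 3 ≤ n := by rw [← hn]; exact_mod_cast hF
  have hn2 : n - 2 ≠ 0 := by linarith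
  have hkP : k * (P - 1) = 2 := by rw [hk, hP]; field_simp; ring
  have hmem : ∀ x : F, x ≠ p → x ≠ -p → stereoInv ι e x ∈ puncturedSphere (ι p) :=
    fun x h1 h2 => stereoInv_mem_puncturedSphere he horth hp h1 h2
  have hNu : ∀ x : F, confDenom x ^ k * stereoPull ι e k v x = v (stereoInv ι e x) := by
    intro x
    rw [stereoPull_eq he horth, ← mul_assoc, ← Real.rpow_add (confDenom_pos x), add_neg_cancel,
      Real.rpow_zero, one_mul]
  have hupos : ∀ x : F, x ≠ p → x ≠ -p → 0 < stereoPull ι e k v x := by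
    intro x h1 h2
    rw [stereoPull_eq he horth]
    exact mul_pos (Real.rpow_pos_of_pos (confDenom_pos x) _) (hpos _ (hmem x h1 h2))
  have heqn : ∀ x : F, x ≠ p → x ≠ -p → -(Δ (stereoPull ι e k v) x) =
      stereoPull ι e k v x ^ P * (v (stereoInv ι e x) ^ (-P) *
        G ⟪stereoInv ι e x, ι p⟫_ℝ (v (stereoInv ι e x))) := by
    intro x h1 h2
    have hm := hmem x h1 h2
    have hN := confDenom_pos x
    have hv := hpos _ hm
    rw [laplacian_stereoPull he horth hdim hn hk (hsmooth _ hm), ← heq _ hm, stereoPull_eq he horth,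
      Real.mul_rpow (Real.rpow_nonneg hN.le _) hv.le, ← Real.rpow_mul hN.le, mul_assoc,
      ← mul_assoc (v (stereoInv ι e x) ^ P), ← Real.rpow_add hv, add_neg_cancel, Real.rpow_zero,
      one_mul]
    have e1 : -k * P = -k - 2 := by linarith
    rw [e1]; ring
  have hvcont : ContinuousOn v (puncturedSphere (ι p)) := by
    intro θ hθ
    refine (hsmooth θ hθ).continuousAt.continuousWithinAt.congr (fun y hy => ?_) ?_
    · rw [hy.1, inv_one, one_smul]
    · rw [hθ.1, inv_one, one_smul]
  refine ⟨hp, hF, by linarith, ?_, hkP, hG, ?_, hupos, ?_, ?_, ?_⟩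
  · rw [hP, one_le_div (by linarith)]; linarith
  · intro x h1 h2
    exact (contDiffAt_rpow_mul_radial he horth k (hsmooth _ (hmem x h1 h2))).comp x
      (contDiff_stereoRay ι e).contDiffAt
  · intro x h1 h2
    rw [heqn x h1 h2, hNu, inner_stereoInv horth]
  · intro r hr
    obtain ⟨δ, hδ, hδ'⟩ := exists_inner_bound hp hr
    set K : Set E := {θ | ‖θ‖ = 1 ∧ |⟪θ, ι p⟫_ℝ| ≤ 1 - δ} with hK
    have hKc : IsCompact K := by
      refine (isCompact_sphere (0 : E) 1).of_isClosed_subset ?_ fun θ hθ => by simpa using hθ.1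
      exact (isClosed_eq continuous_norm continuous_const).inter
        (isClosed_le (f := fun θ : E => |⟪θ, ι p⟫_ℝ|) (by fun_prop) continuous_const)
    have hKD : K ⊆ puncturedSphere (ι p) := by
      have hpp : ⟪ι p, ι p⟫_ℝ = 1 := by rw [real_inner_self_eq_norm_sq, ι.norm_map, hp]; norm_num
      rintro θ ⟨h1, h2⟩
      refine ⟨h1, ?_, ?_⟩
      · rintro rfl; rw [hpp] at h2; norm_num at h2; linarith
      · rintro rfl; rw [inner_neg_left, hpp] at h2; norm_num at h2; linarith
    have hKm : ∀ x : F, r ≤ ‖x - p‖ → r ≤ ‖x + p‖ → stereoInv ι e x ∈ K := by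
      intro x h1 h2
      refine ⟨norm_stereoInv he horth x, ?_⟩
      rw [inner_stereoInv horth, abs_le]
      refine ⟨?_, hδ' x h1⟩
      have := hδ' (-x) (by rwa [← norm_neg, neg_sub, sub_neg_eq_add, add_comm])
      rw [inner_neg_left, confDenom, norm_neg, ← confDenom, neg_div] at this
      linarith
    have hvK := hvcont.mono hKD
    obtain ⟨c, hc, hcK⟩ := hKc.exists_forall_le' hvK (a := 0) fun θ hθ => hpos θ (hKD hθ)
    obtain ⟨C, hC⟩ := hKc.exists_bound_of_continuousOn hvK
    have hgK : ContinuousOn (fun θ => v θ ^ (-P) * G ⟪θ, ι p⟫_ℝ (v θ)) K := by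
      refine (hvK.rpow_const fun θ hθ => Or.inl (hpos θ (hKD hθ)).ne').mul ?_
      exact hcont.comp (continuousOn_id.prodMk hvK) fun θ hθ => ⟨hKD hθ, hpos θ (hKD hθ)⟩
    obtain ⟨B, hB⟩ := hKc.exists_bound_of_continuousOn hgK
    refine ⟨c, C, max B 0, hc, le_max_right _ _, fun x h1 h2 => ?_⟩
    have hx := hKm x h1 h2
    obtain ⟨hx1, hx2⟩ := ne_of_le_norm hr h1 h2
    rw [hNu, heqn x hx1 hx2, mul_comm (max B 0)]
    refine ⟨hcK _ hx, (le_abs_self _).trans (hC _ hx), ?_⟩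
    exact mul_le_mul_of_nonneg_left (((le_abs_self _).trans (hB _ hx)).trans (le_max_left _ _))
      (Real.rpow_nonneg (hupos x hx1 hx2).le _)
  · obtain ⟨c₁, r₁, hc₁, hr₁, h₁⟩ := exists_pole_bound he horth hp hp k hnorth
    obtain ⟨c₂, r₂, hc₂, hr₂, h₂⟩ := exists_pole_bound he horth hp (q := -p)
      (by rwa [norm_neg]) k (by simpa using hsouth)
    refine ⟨min c₁ c₂, min r₁ r₂, lt_min hc₁ hc₂, lt_min hr₁ hr₂, fun x hx1 hx2 hx => ?_⟩
    rw [stereoPull_eq he horth]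
    rcases hx with hx | hx
    · exact (min_le_left _ _).trans (h₁ x hx1 hx2 (hx.trans_le (min_le_left _ _)))
    · refine (min_le_right _ _).trans (h₂ x hx1 hx2 ?_)
      rw [sub_neg_eq_add]
      exact hx.trans_le (min_le_right _ _)

end SphereSolution

section Symmetry

variable {E : Type*} [NormedAddCommGroup E] [InnerProductSpace ℝ E] [FiniteDimensional ℝ E]

theorem exists_unit_orthogonal_pair (hdim : 3 ≤ Module.finrank ℝ E) (x y : E) :
    ∃ e : E, ‖e‖ = 1 ∧ ⟪x, e⟫_ℝ = 0 ∧ ⟪y, e⟫_ℝ = 0 := by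
  have h1 : Module.finrank ℝ (Submodule.span ℝ ({x, y} : Set E)) ≤ 2 := by
    classical
    have h := finrank_span_finset_le_card (R := ℝ) ({x, y} : Finset E)
    rw [Finset.coe_pair] at h
    exact h.trans Finset.card_le_two
  have h2 : (Submodule.span ℝ ({x, y} : Set E))ᗮ ≠ ⊥ := by
    intro h
    rw [Submodule.orthogonal_eq_bot_iff] at h
    rw [h, finrank_top] at h1
    omega
  obtain ⟨w, hw, hw0⟩ := Submodule.exists_mem_ne_zero_of_ne_bot h2
  have hx := (Submodule.mem_orthogonal _ w).1 hw x (Submodule.subset_span (by simp))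
  have hy := (Submodule.mem_orthogonal _ w).1 hw y (Submodule.subset_span (by simp))
  refine ⟨‖w‖⁻¹ • w, norm_smul_inv_norm (𝕜 := ℝ) hw0, ?_, ?_⟩
  · rw [inner_smul_right, hx, mul_zero]
  · rw [inner_smul_right, hy, mul_zero]

theorem eq_of_inner_eq_of_conformal_equation {n P : ℝ} (hdim : 4 ≤ Module.finrank ℝ E)
    (hn : (Module.finrank ℝ E : ℝ) = n + 1) (hP : P = (n + 2) / (n - 2))
    {q : E} (hq : ‖q‖ = 1) {v : E → ℝ} {G : ℝ → ℝ → ℝ}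
    (hsmooth : ∀ θ ∈ puncturedSphere q, ContDiffAt ℝ 2 (fun y => v (‖y‖⁻¹ • y)) θ)
    (hpos : ∀ θ ∈ puncturedSphere q, 0 < v θ)
    (heq : ∀ θ ∈ puncturedSphere q,
      -((Δ (fun y : E => v (‖y‖⁻¹ • y))) θ - n * (n - 2) / 4 * v θ) = G ⟪θ, q⟫_ℝ (v θ))
    (hcont : ContinuousOn (fun r : E × ℝ => G ⟪r.1, q⟫_ℝ r.2) (puncturedSphere q ×ˢ Set.Ioi 0))
    (hnorth : ∃ c : ℝ, 0 < c ∧ ∀ᶠ θ in 𝓝[puncturedSphere q] q, c ≤ v θ)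
    (hsouth : ∃ c : ℝ, 0 < c ∧ ∀ᶠ θ in 𝓝[puncturedSphere q] (-q), c ≤ v θ)
    (hG : NonlinAdm fun t s => s ^ (-P) * G t s) {θ θ' : E} (hθ : θ ∈ puncturedSphere q)
    (hθ' : θ' ∈ puncturedSphere q) (h : ⟪θ, q⟫_ℝ = ⟪θ', q⟫_ℝ) : v θ = v θ' := by
  rcases eq_or_ne θ θ' with rfl | hne
  · rfl
  set d := ‖θ - θ'‖ with hd
  have hd0 : 0 < d := norm_pos_iff.2 (sub_ne_zero.2 hne)
  set a₀ := d⁻¹ • (θ - θ') with ha₀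
  have hθa : θ' = θ - d • a₀ := by
    rw [ha₀, smul_smul, mul_inv_cancel₀ hd0.ne', one_smul, sub_sub_cancel]
  have ha₀n : ‖a₀‖ = 1 := norm_smul_inv_norm (𝕜 := ℝ) (sub_ne_zero.2 hne)
  have ha₀q : ⟪a₀, q⟫_ℝ = 0 := by
    rw [ha₀, real_inner_smul_left, inner_sub_left, h, sub_self, mul_zero]
  have hθa₀ : 2 * ⟪θ, a₀⟫_ℝ = d := by
    have h1 : d ^ 2 = 2 - 2 * ⟪θ, θ'⟫_ℝ := by rw [hd, norm_sub_sq_real, hθ.1, hθ'.1]; ring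
    rw [ha₀, real_inner_smul_right, inner_sub_right, real_inner_self_eq_norm_sq, hθ.1]
    field_simp
    linarith
  obtain ⟨e, he, hqe, hae⟩ := exists_unit_orthogonal_pair (by omega) q a₀
  have hθe : ⟪θ', e⟫_ℝ = ⟪θ, e⟫_ℝ := by
    rw [hθa, inner_sub_left, real_inner_smul_left, hae]; ring
  have hlt : ⟪θ, e⟫_ℝ < 1 := by
    refine lt_of_le_of_ne ?_ fun h1 => ?_
    · simpa [hθ.1, he] using real_inner_le_norm θ e
    · rw [inner_eq_one_iff_of_norm_eq_one hθ.1 he] at h1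
      rw [h1, real_inner_comm, hae] at hθa₀
      linarith
  set ι := (ℝ ∙ e)ᗮ.subtypeₗᵢ with hι
  have horth : ∀ x, ⟪ι x, e⟫_ℝ = 0 := fun x => by
    rw [real_inner_comm]; exact Submodule.mem_orthogonal_singleton_iff_inner_right.1 x.2
  have hmem : ∀ w : E, ⟪w, e⟫_ℝ = 0 → ∃ y, ι y = w := fun w hw =>
    ⟨⟨w, Submodule.mem_orthogonal_singleton_iff_inner_left.2 hw⟩, rfl⟩
  have hee : ⟪e, e⟫_ℝ = 1 := by rw [real_inner_self_eq_norm_sq, he]; norm_num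
  have he0 : e ≠ 0 := by rintro rfl; simp at he
  have hdimF : Module.finrank ℝ E = Module.finrank ℝ (ℝ ∙ e)ᗮ + 1 := by
    have h1 := Submodule.finrank_add_finrank_orthogonal (ℝ ∙ e)
    rw [finrank_span_singleton he0] at h1
    omega
  obtain ⟨p, rfl⟩ := hmem q hqe
  obtain ⟨a, ha⟩ := hmem a₀ hae
  obtain ⟨y, hy⟩ := hmem (θ - ⟪θ, e⟫_ℝ • e) (by
    rw [inner_sub_left, real_inner_smul_left, hee]; ring)
  have hp : ‖p‖ = 1 := by rwa [ι.norm_map] at hq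
  have han : ‖a‖ = 1 := by rwa [← ha, ι.norm_map] at ha₀n
  have hap : ⟪a, p⟫_ℝ = 0 := by rwa [← ha, ι.inner_map_map] at ha₀q
  have hnF : (Module.finrank ℝ (ℝ ∙ e)ᗮ : ℝ) = n := by
    rw [hdimF] at hn; push_cast at hn; linarith
  have hu := projSolution_of_sphere he horth hdimF (by omega) hnF rfl hP hp hsmooth hpos heq hcont
    hnorth hsouth hG
  obtain ⟨hN, hΦ⟩ := stereoInv_inv_smul he hθ.1 hlt hy
  have hya : ⟪y, a⟫_ℝ = d / 2 := by
    rw [← ι.inner_map_map, hy, ha, inner_sub_left, real_inner_smul_left, real_inner_comm a₀ e, hae]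
    linarith
  have hy' : ι (planeRefl a 0 y) = θ' - ⟪θ', e⟫_ℝ • e := by
    rw [planeRefl, map_add, map_smul, hy, ha, hya, hθe, hθa]
    module
  obtain ⟨hN', hΦ'⟩ := stereoInv_inv_smul he hθ'.1 (hθe ▸ hlt) hy'
  have hrefl : planeRefl a 0 ((1 - ⟪θ, e⟫_ℝ)⁻¹ • y) = (1 - ⟪θ', e⟫_ℝ)⁻¹ • planeRefl a 0 y := by
    rw [planeRefl, planeRefl, hθe, real_inner_smul_left]
    module
  have hx1 : (1 - ⟪θ, e⟫_ℝ)⁻¹ • y ≠ p := by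
    intro hx
    rw [hx, stereoInv_of_norm_eq_one _ _ hp] at hΦ
    exact hθ.2.1 hΦ.symm
  have hx2 : (1 - ⟪θ, e⟫_ℝ)⁻¹ • y ≠ -p := by
    intro hx
    rw [hx, stereoInv_of_norm_eq_one _ _ (by rwa [norm_neg]), map_neg] at hΦ
    exact hθ.2.2 hΦ.symm
  have key := hu.comp_planeRefl_zero hap han hx1 hx2
  rw [hrefl, stereoPull_eq he horth, stereoPull_eq he horth, hΦ, hΦ', hN, hN', hθe] at key
  exact (mul_left_cancel₀ (Real.rpow_pos_of_pos (inv_pos.2 (by linarith)) _).ne' key).symm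

end Symmetry

section Euclidean

theorem eLaplacian_eq_laplacian {m : ℕ} (u : EuclideanSpace ℝ (Fin m) → ℝ)
    (x : EuclideanSpace ℝ (Fin m)) : eLaplacian u x = Δ u x := by
  rw [InnerProductSpace.laplacian_eq_iteratedFDeriv_orthonormalBasis u
    (EuclideanSpace.basisFun (Fin m) ℝ)]
  simp [eLaplacian]

theorem inner_eq_apply_last {n : ℕ} (θ : EuclideanSpace ℝ (Fin (n + 1))) :
    ⟪θ, EuclideanSpace.single (Fin.last n) 1⟫_ℝ = θ (Fin.last n) := by
  simp [EuclideanSpace.inner_single_right]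

theorem puncturedSphere_eq {m : ℕ} (q : EuclideanSpace ℝ (Fin m)) :
    puncturedSphere q = Metric.sphere 0 1 \ {q, -q} := by
  ext θ; simp [puncturedSphere]

theorem exists_mem_puncturedSphere_inner_eq {E : Type*} [NormedAddCommGroup E]
    [InnerProductSpace ℝ E] [FiniteDimensional ℝ E] (hdim : 3 ≤ Module.finrank ℝ E) {q : E}
    (hq : ‖q‖ = 1) {t : ℝ} (ht : t ∈ Set.Ioo (-1 : ℝ) 1) :
    ∃ θ ∈ puncturedSphere q, ⟪θ, q⟫_ℝ = t := by
  obtain ⟨e, he, hqe, -⟩ := exists_unit_orthogonal_pair hdim q q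
  have hqq : ⟪q, q⟫_ℝ = 1 := by rw [real_inner_self_eq_norm_sq, hq]; norm_num
  have hin : ⟪t • q + √(1 - t ^ 2) • e, q⟫_ℝ = t := by
    rw [inner_add_left, real_inner_smul_left, real_inner_smul_left, hqq, real_inner_comm, hqe]
    ring
  have hnorm : ‖t • q + √(1 - t ^ 2) • e‖ ^ 2 = 1 := by
    rw [norm_add_sq_real, norm_smul, norm_smul, hq, he, real_inner_smul_left, real_inner_smul_right,
      hqe, mul_one, mul_one, Real.norm_eq_abs, sq_abs, Real.norm_eq_abs, sq_abs,
      Real.sq_sqrt (by nlinarith [ht.1, ht.2])]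
    ring
  refine ⟨_, ⟨(pow_eq_one_iff_of_nonneg (norm_nonneg _) two_ne_zero).1 hnorm, fun h => ?_,
    fun h => ?_⟩, hin⟩
  · rw [h, hqq] at hin; linarith [ht.2]
  · rw [h, inner_neg_left, hqq] at hin; linarith [ht.1]

end Euclidean

end MovingPlaneMethod

theorem stmt10 (n : ℕ) (hn : 3 ≤ n)
    -- the unit sphere, the north pole and the south pole
    (S : Set (EuclideanSpace ℝ (Fin (n + 1))))
    (hS : S = Metric.sphere (0 : EuclideanSpace ℝ (Fin (n + 1))) 1)
    (north south : EuclideanSpace ℝ (Fin (n + 1)))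
    (hnorth : north = EuclideanSpace.single (Fin.last n) 1)
    (hsouth : south = -north)
    (g : EuclideanSpace ℝ (Fin (n + 1)) → ℝ → ℝ)
    -- g continuous on (Sⁿ \ {n, s}) × (0,∞)
    (hg_cont : ContinuousOn (fun q : (EuclideanSpace ℝ (Fin (n + 1))) × ℝ => g q.1 q.2)
      ((S \ {north, south}) ×ˢ Set.Ioi (0 : ℝ)))
    -- g(·,s) is bounded from below on Sⁿ \ {n, s} for each s > 0
    (hg_bdd : ∀ s : ℝ, 0 < s → ∃ M : ℝ, ∀ θ ∈ S \ {north, south}, M ≤ g θ s)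
    -- (g1), (g3), (g5), (g6)
    (hG : ∃ G : ℝ → ℝ → ℝ,
      -- (g1)
      (∀ θ ∈ S \ {north, south}, ∀ s : ℝ, 0 < s → g θ s = G (θ (Fin.last n)) s) ∧
      -- (g3)
      (∀ t ∈ Set.Ioo (-1 : ℝ) 1,
        AntitoneOn (fun s : ℝ => s ^ (-(((n : ℝ) + 2) / ((n : ℝ) - 2))) * G t s)
          (Set.Ioi 0)) ∧
      -- (g5)
      (∀ s : ℝ, 0 < s → ∀ t t' : ℝ, t < 1 → t' < t → 0 < t' → G t' s ≤ G t s) ∧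
      (∀ s : ℝ, 0 < s → ∀ t t' : ℝ, -1 < t → t < t' → t' < 0 → G t' s ≤ G t s) ∧
      -- (g6)
      (((∀ s : ℝ, 0 < s → ∀ t t' : ℝ, t < 1 → t' < t → 0 < t' → G t' s < G t s) ∧
        (∀ s : ℝ, 0 < s → ∀ t t' : ℝ, -1 < t → t < t' → t' < 0 → G t' s < G t s)) ∨
       (∀ t ∈ Set.Ioo (-1 : ℝ) 1,
        StrictAntiOn (fun s : ℝ => s ^ (-(((n : ℝ) + 2) / ((n : ℝ) - 2))) * G t s)
          (Set.Ioi 0))))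
    (v : EuclideanSpace ℝ (Fin (n + 1)) → ℝ)
    -- v ∈ C²(Sⁿ \ {n, s}), via its degree-zero homogeneous extension
    (hv : ContDiffOn ℝ 2 (fun x => v (‖x‖⁻¹ • x))
      {x | x ≠ 0 ∧ ‖x‖⁻¹ • x ≠ north ∧ ‖x‖⁻¹ • x ≠ south})
    (hvpos : ∀ θ ∈ S \ {north, south}, 0 < v θ)
    -- the equation −L_{Sⁿ} v = g(θ, v)
    (heq : ∀ θ ∈ S \ {north, south},
      -(sphLaplacian v θ - ((n : ℝ) * ((n : ℝ) - 2) / 4) * v θ) = g θ (v θ))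
    -- liminf_{θ → n} v(θ) > 0 and liminf_{θ → s} v(θ) > 0
    (hliminf_n : ∃ c : ℝ, 0 < c ∧
      ∀ᶠ θ in nhdsWithin north (S \ {north, south}), c ≤ v θ)
    (hliminf_s : ∃ c : ℝ, 0 < c ∧
      ∀ᶠ θ in nhdsWithin south (S \ {north, south}), c ≤ v θ) :
    -- v is rotationally symmetric about the line through n and s
    ∀ θ ∈ S \ {north, south}, ∀ θ' ∈ S \ {north, south},
      θ (Fin.last n) = θ' (Fin.last n) → v θ = v θ' := by
  have hnorm : ‖north‖ = 1 := by simp [hnorth]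
  have hin : ∀ θ, inner ℝ θ north = θ (Fin.last n) := hnorth ▸ inner_eq_apply_last
  have hD : S \ {north, south} = puncturedSphere north := by
    rw [puncturedSphere_eq, hS, hsouth]
  have hdim : Module.finrank ℝ (EuclideanSpace ℝ (Fin (n + 1))) = n + 1 := by simp
  obtain ⟨G, hg, hanti, hmono_pos, hmono_neg, hstrict⟩ := hG
  rw [hD] at hg_cont hvpos heq hliminf_n hliminf_s hg ⊢
  have hcont : ContinuousOn
      (fun r : EuclideanSpace ℝ (Fin (n + 1)) × ℝ => G (inner ℝ r.1 north) r.2)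
      (puncturedSphere north ×ˢ Set.Ioi 0) :=
    hg_cont.congr fun r hr => by rw [hin]; exact (hg r.1 hr.1 r.2 hr.2).symm
  have hadm : NonlinAdm fun t s => s ^ (-(((n : ℝ) + 2) / ((n : ℝ) - 2))) * G t s := by
    refine ⟨hanti, fun s hs t t' h1 h2 h3 => ?_, fun s hs t t' h1 h2 h3 => ?_, ?_, fun t ht => ?_⟩
    · exact mul_le_mul_of_nonneg_left (hmono_pos s hs t t' h1 h2 h3) (Real.rpow_nonneg hs.le _)
    · exact mul_le_mul_of_nonneg_left (hmono_neg s hs t t' h1 h2 h3) (Real.rpow_nonneg hs.le _)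
    · refine hstrict.imp_left fun h => ⟨fun s hs t t' h1 h2 h3 => ?_, fun s hs t t' h1 h2 h3 => ?_⟩
      · exact mul_lt_mul_of_pos_left (h.1 s hs t t' h1 h2 h3) (Real.rpow_pos_of_pos hs _)
      · exact mul_lt_mul_of_pos_left (h.2 s hs t t' h1 h2 h3) (Real.rpow_pos_of_pos hs _)
    · obtain ⟨θ, hθ, rfl⟩ := exists_mem_puncturedSphere_inner_eq (by omega) hnorm ht
      refine ContinuousOn.mul
        (fun s hs => (Real.continuousAt_rpow_const s _ (Or.inl hs.ne')).continuousWithinAt) ?_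
      exact hcont.comp (f := fun s : ℝ => (θ, s)) (by fun_prop) fun s hs => ⟨hθ, hs⟩
  have hsmooth : ∀ θ ∈ puncturedSphere north, ContDiffAt ℝ 2 (fun y => v (‖y‖⁻¹ • y)) θ := by
    intro θ hθ
    have h0 : θ ≠ 0 := by rw [← norm_pos_iff, hθ.1]; exact one_pos
    have hc : ContinuousAt (fun y : EuclideanSpace ℝ (Fin (n + 1)) => ‖y‖⁻¹ • y) θ :=
      (continuousAt_id.norm.inv₀ (norm_ne_zero_iff.2 h0)).smul continuousAt_id
    have h1 : ‖θ‖⁻¹ • θ = θ := by rw [hθ.1, inv_one, one_smul]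
    refine hv.contDiffAt ?_
    filter_upwards [isOpen_ne.mem_nhds h0, hc.eventually_ne (h1.trans_ne hθ.2.1),
      hc.eventually_ne (h1.trans_ne (hsouth ▸ hθ.2.2 : θ ≠ south))] with y h2 h3 h4
      using ⟨h2, h3, h4⟩
  intro θ hθ θ' hθ' h
  refine eq_of_inner_eq_of_conformal_equation (n := n) (by omega) (by rw [hdim]; push_cast; rfl) rfl
    hnorm hsmooth hvpos (fun θ hθ => ?_) hcont hliminf_n (hsouth ▸ hliminf_s) hadm hθ hθ'
    (by rw [hin, hin, h])
  rw [hin, ← hg θ hθ _ (hvpos θ hθ), ← heq θ hθ, sphLaplacian, eLaplacian_eq_laplacian]
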